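/- Under assumptions (A1)–(A4): for every bounded Lipschitz function φ : (0,1) → ℝ and all x, y ∈ (0,1), |Uⁿφ(x) − Uⁿφ(y)| → 0 as n → ∞. -/

import Mathlib

/-
Formalization of the Alsedà–Misiurewicz system setup:
`f0, f1` are the piecewise-linear interval homeomorphisms, `iter` the random
iteration along ω ∈ Σ = {0,1}^ℕ, `IsKernel` characterises the family x ↦ ℙ_x by
its values on cylinder sets, `Pop` is the Markov operator (as a set function),
`Stationary` expresses P-invariance for probability measures on (0,1), `U` is
the dual operator, and `A1`–`A4` are the assumptions of the paper.
-/

open MeasureTheory Filter Set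
open scoped ENNReal Topology

namespace AM

noncomputable def f0 (x₀ y₀ : ℝ) (x : ℝ) : ℝ :=
  if x ≤ x₀ then (y₀ / x₀) * x else ((1 - y₀) / (1 - x₀)) * (x - 1) + 1

noncomputable def f1 (x₀ y₀ : ℝ) (x : ℝ) : ℝ := 1 - f0 x₀ y₀ (1 - x)

/-- `fb b` is `f₁` if `b = true`, and `f₀` if `b = false`. -/
noncomputable def fb (x₀ y₀ : ℝ) (b : Bool) : ℝ → ℝ :=
  if b then f1 x₀ y₀ else f0 x₀ y₀

/-- `iter x₀ y₀ ω n x = f^n_ω(x) = f_{ω (n-1)} ∘ ⋯ ∘ f_{ω 0} (x)`, with `f^0_ω = id`. -/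
noncomputable def iter (x₀ y₀ : ℝ) (ω : ℕ → Bool) : ℕ → ℝ → ℝ
  | 0, x => x
  | n + 1, x => fb x₀ y₀ (ω n) (iter x₀ y₀ ω n x)

/-- `cylProb x₀ y₀ p₀ p₁ x w = p_{i₁}(x) p_{i₂}(f_{i₁} x) ⋯` for the word `w = (i₁, …, i_k)`. -/
noncomputable def cylProb (x₀ y₀ : ℝ) (p₀ p₁ : ℝ → ℝ) : ℝ → List Bool → ℝ
  | _, [] => 1
  | x, b :: w => (if b then p₁ x else p₀ x) * cylProb x₀ y₀ p₀ p₁ (fb x₀ y₀ b x) w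

/-- The cylinder set of sequences starting with the word `w`. -/
def cyl (w : List Bool) : Set (ℕ → Bool) := {ω | ∀ j : Fin w.length, ω j = w.get j}

/-- `IsKernel x₀ y₀ p₀ p₁ Pm` says that `Pm x = ℙ_x` for all `x ∈ (0,1)`, i.e. `Pm x` gives
every cylinder set its prescribed probability (this determines `Pm x` uniquely and makes it a
probability measure, since the empty word gives `Pm x univ = 1`). -/
def IsKernel (x₀ y₀ : ℝ) (p₀ p₁ : ℝ → ℝ) (Pm : ℝ → Measure (ℕ → Bool)) : Prop :=
  ∀ x ∈ Ioo (0:ℝ) 1, ∀ w : List Bool,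
    Pm x (cyl w) = ENNReal.ofReal (cylProb x₀ y₀ p₀ p₁ x w)

/-- The Markov operator `P`, as a set function:
`Pop μ A = ∫_{f₀⁻¹(A)} p₀ dμ + ∫_{f₁⁻¹(A)} p₁ dμ`. -/
noncomputable def Pop (x₀ y₀ : ℝ) (p₀ p₁ : ℝ → ℝ) (μ : Measure ℝ) (A : Set ℝ) : ℝ≥0∞ :=
  (∫⁻ x in f0 x₀ y₀ ⁻¹' A, ENNReal.ofReal (p₀ x) ∂μ) +
    ∫⁻ x in f1 x₀ y₀ ⁻¹' A, ENNReal.ofReal (p₁ x) ∂μ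

/-- A stationary (P-invariant) Borel probability measure on (0,1). -/
def Stationary (x₀ y₀ : ℝ) (p₀ p₁ : ℝ → ℝ) (μ : Measure ℝ) : Prop :=
  IsProbabilityMeasure μ ∧ μ (Ioo 0 1) = 1 ∧
    ∀ A : Set ℝ, MeasurableSet A → A ⊆ Ioo 0 1 → μ A = Pop x₀ y₀ p₀ p₁ μ A

/-- The dual operator `Uφ(x) = p₀(x) φ(f₀ x) + p₁(x) φ(f₁ x)`. -/
noncomputable def U (x₀ y₀ : ℝ) (p₀ p₁ : ℝ → ℝ) (φ : ℝ → ℝ) : ℝ → ℝ :=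
  fun x => p₀ x * φ (f0 x₀ y₀ x) + p₁ x * φ (f1 x₀ y₀ x)

/-- Assumption (A1): `1/2 < x₀ < 1` and `1/2 ≤ y₀ < x₀`. -/
def A1 (x₀ y₀ : ℝ) : Prop := 1/2 < x₀ ∧ x₀ < 1 ∧ 1/2 ≤ y₀ ∧ y₀ < x₀

/-- Assumption (A2): Dini continuity of `p₀, p₁`; `β` is a modulus of continuity for both, with
`∑ₙ β(C tⁿ) < ∞` for all `C ≥ 0`, `0 < t < 1`. (Such a `β` exists iff the least modulus of
continuity has this summability property.) -/
def A2 (p₀ p₁ : ℝ → ℝ) : Prop :=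
  ∃ β : ℝ → ℝ,
    (∀ t : ℝ, ∀ x ∈ Icc (0:ℝ) 1, ∀ y ∈ Icc (0:ℝ) 1, |x - y| ≤ t →
      |p₀ x - p₀ y| ≤ β t ∧ |p₁ x - p₁ y| ≤ β t) ∧
    (∀ C : ℝ, 0 ≤ C → ∀ t : ℝ, 0 < t → t < 1 → Summable fun n : ℕ => β (C * t ^ n))

/-- Assumption (A3): `p₀, p₁` are continuous, `p₀ + p₁ = 1`, and `0 < pᵢ < 1` on `[0,1]`. -/
def A3 (p₀ p₁ : ℝ → ℝ) : Prop :=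
  ContinuousOn p₀ (Icc 0 1) ∧ ContinuousOn p₁ (Icc 0 1) ∧
    ∀ x ∈ Icc (0:ℝ) 1, p₀ x + p₁ x = 1 ∧ 0 < p₀ x ∧ p₀ x < 1 ∧ 0 < p₁ x ∧ p₁ x < 1

/-- Assumption (A4): the average Lyapunov exponents at 0 and 1 are positive
(`a₀ = y₀/x₀`, `a₁ = (1-y₀)/(1-x₀)`). -/
def A4 (x₀ y₀ : ℝ) (p₀ p₁ : ℝ → ℝ) : Prop :=
  0 < p₀ 0 * Real.log (y₀ / x₀) + p₁ 0 * Real.log ((1 - y₀) / (1 - x₀)) ∧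
    0 < p₀ 1 * Real.log ((1 - y₀) / (1 - x₀)) + p₁ 1 * Real.log (y₀ / x₀)

end AM

/-- A modulus bound `β t` at scale `t` propagates to all scales by chaining. -/
lemma abs_sub_le_of_local_modulus {p : ℝ → ℝ} {t c : ℝ} (ht : 0 < t)
    (h : ∀ x ∈ Icc (0:ℝ) 1, ∀ y ∈ Icc (0:ℝ) 1, |x - y| ≤ t → |p x - p y| ≤ c)
    {x y w : ℝ} (hx : x ∈ Icc (0:ℝ) 1) (hy : y ∈ Icc (0:ℝ) 1) (hw : |x - y| ≤ w) :
    |p x - p y| ≤ c * (1 + w / t) := by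
  have hc : 0 ≤ c := (abs_nonneg _).trans (h x hx x hx (by simpa using ht.le))
  have chain : ∀ n : ℕ, ∀ y ∈ Icc (0:ℝ) 1, |x - y| ≤ n * t → |p x - p y| ≤ n * c := by
    intro n
    induction n with
    | zero =>
      intro y _ hxy
      have : x = y := by
        have := abs_nonpos_iff.1 (by simpa using hxy : |x - y| ≤ 0)
        linarith
      simp [this]
    | succ n ih =>
      intro y hy hxy
      push_cast at hxy ⊢
      have hn : (0:ℝ) < n + 1 := by positivity
      set k : ℝ := n / (n + 1) with hk
      have hk0 : 0 ≤ k := by positivity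
      have hk1 : 1 - k = 1 / (n + 1) := by rw [hk]; field_simp; ring
      have hk1' : 0 ≤ 1 - k := by rw [hk1]; positivity
      set z := (1 - k) * x + k * y with hz
      have hzI : z ∈ Icc (0:ℝ) 1 := by
        have := convex_Icc (0:ℝ) 1 hx hy hk1' hk0 (by ring)
        simpa [hz] using this
      have h1 : |x - z| ≤ n * t := by
        have : x - z = k * (x - y) := by rw [hz]; ring
        rw [this, abs_mul, abs_of_nonneg hk0]
        calc k * |x - y| ≤ k * ((n + 1) * t) := by gcongr
          _ = n * t := by rw [hk]; field_simp
      have h2 : |z - y| ≤ t := by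
        have : z - y = (1 - k) * (x - y) := by rw [hz]; ring
        rw [this, abs_mul, abs_of_nonneg hk1']
        calc (1 - k) * |x - y| ≤ (1 - k) * ((n + 1) * t) := by gcongr
          _ = t := by rw [hk1]; field_simp
      calc |p x - p y| ≤ |p x - p z| + |p z - p y| := abs_sub_le _ _ _
        _ ≤ n * c + c := add_le_add (ih z hzI h1) (h z hzI y hy h2)
        _ = (n + 1) * c := by ring
  have hw0 : 0 ≤ w := (abs_nonneg _).trans hw
  calc |p x - p y| ≤ ⌈w / t⌉₊ * c := by
        refine chain _ y hy (hw.trans ?_)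
        rw [← div_le_iff₀ ht]
        exact Nat.le_ceil _
    _ ≤ (w / t + 1) * c := by
        gcongr
        exact (Nat.ceil_lt_add_one (by positivity)).le
    _ = c * (1 + w / t) := by ring

/-- For a Dini continuous function `p` there is a concave modulus `H` which decreases by more
than the oscillation of `p` when its argument is multiplied by `l`. -/
lemma exists_concave_dini_modulus {p β : ℝ → ℝ} {l : ℝ} (hl0 : 0 < l)
    (hβ : ∀ t : ℝ, ∀ x ∈ Icc (0:ℝ) 1, ∀ y ∈ Icc (0:ℝ) 1, |x - y| ≤ t → |p x - p y| ≤ β t)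
    (hs : Summable fun n : ℕ => β (l ^ n)) :
    ∃ H : ℝ → ℝ, ConcaveOn ℝ (Ici 0) H ∧ MonotoneOn H (Ici 0) ∧ (∀ w, 0 ≤ w → 0 ≤ H w) ∧
      (∀ x ∈ Icc (0:ℝ) 1, ∀ y ∈ Icc (0:ℝ) 1, ∀ w, |x - y| ≤ w →
        H (l * w) + |p x - p y| ≤ H w) ∧
      ∀ ε, 0 < ε → ∃ δ, 0 < δ ∧ ∀ w, 0 ≤ w → w < δ → H w ≤ ε := by
  have hlp : ∀ n : ℕ, 0 < l ^ n := fun n => pow_pos hl0 n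
  have hβ0 : ∀ n : ℕ, 0 ≤ β (l ^ n) := fun n =>
    (abs_nonneg _).trans (hβ (l ^ n) 0 (by simp) 0 (by simp) (by simpa using (hlp n).le))
  set b : ℝ → ℝ := fun s => ⨅ n : ℕ, β (l ^ n) * (1 + s / l ^ n) with hb
  have hnn : ∀ s, 0 ≤ s → ∀ n : ℕ, 0 ≤ β (l ^ n) * (1 + s / l ^ n) := fun s hs n =>
    mul_nonneg (hβ0 n) (add_nonneg zero_le_one (div_nonneg hs (hlp n).le))
  have hbdd : ∀ s, 0 ≤ s → BddBelow (range fun n : ℕ => β (l ^ n) * (1 + s / l ^ n)) :=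
    fun s hs => ⟨0, by rintro _ ⟨n, rfl⟩; exact hnn s hs n⟩
  have b_nonneg : ∀ s, 0 ≤ s → 0 ≤ b s := fun s hs => le_ciInf (hnn s hs)
  have b_le : ∀ s, 0 ≤ s → ∀ n : ℕ, b s ≤ β (l ^ n) * (1 + s / l ^ n) :=
    fun s hs n => ciInf_le (hbdd s hs) n
  have b_mono : ∀ s t, 0 ≤ s → s ≤ t → b s ≤ b t := fun s t hs hst =>
    le_ciInf fun n => (b_le s hs n).trans <| by
      have := hβ0 n
      have := hlp n
      gcongr
  have b_conc : ConcaveOn ℝ (Ici 0) b := by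
    refine ⟨convex_Ici 0, fun x hx y hy c d hc hd hcd => le_ciInf fun n => ?_⟩
    have h1 := mul_le_mul_of_nonneg_left (b_le x hx n) hc
    have h2 := mul_le_mul_of_nonneg_left (b_le y hy n) hd
    simp only [smul_eq_mul]
    refine (add_le_add h1 h2).trans (le_of_eq ?_)
    have : d = 1 - c := by linarith
    subst this
    ring
  have b_mod : ∀ x ∈ Icc (0:ℝ) 1, ∀ y ∈ Icc (0:ℝ) 1, ∀ w, |x - y| ≤ w → |p x - p y| ≤ b w :=
    fun x hx y hy w hw => le_ciInf fun n =>
      abs_sub_le_of_local_modulus (hlp n) (hβ (l ^ n)) hx hy hw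
  have b_sum : ∀ w, 0 ≤ w → Summable fun k : ℕ => b (l ^ k * w) := by
    intro w hw
    refine Summable.of_nonneg_of_le (fun k => b_nonneg _ (mul_nonneg (hlp k).le hw)) (fun k => ?_)
      (hs.mul_right (1 + w))
    refine (b_le _ (mul_nonneg (hlp k).le hw) k).trans (le_of_eq ?_)
    rw [mul_div_cancel_left₀ _ (hlp k).ne']
  refine ⟨fun w => ∑' k : ℕ, b (l ^ k * w), ?_, ?_, ?_, ?_, ?_⟩
  · refine ⟨convex_Ici 0, fun x hx y hy c d hc hd hcd => ?_⟩
    have hxy : 0 ≤ c * x + d * y := add_nonneg (mul_nonneg hc hx) (mul_nonneg hd hy)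
    simp only [smul_eq_mul]
    rw [← tsum_mul_left, ← tsum_mul_left,
      ← ((b_sum x hx).mul_left c).tsum_add ((b_sum y hy).mul_left d)]
    refine Summable.tsum_le_tsum (fun k => ?_)
      (((b_sum x hx).mul_left c).add ((b_sum y hy).mul_left d)) (b_sum _ hxy)
    have := b_conc.2 (mul_nonneg (hlp k).le hx : l ^ k * x ∈ Ici 0)
      (mul_nonneg (hlp k).le hy : l ^ k * y ∈ Ici 0) hc hd hcd
    simp only [smul_eq_mul] at this
    refine this.trans (le_of_eq ?_)
    congr 1
    ring
  · intro x hx y hy hxy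
    refine Summable.tsum_le_tsum (fun k => ?_) (b_sum x hx) (b_sum y hy)
    exact b_mono _ _ (mul_nonneg (hlp k).le hx) (mul_le_mul_of_nonneg_left hxy (hlp k).le)
  · exact fun w hw => tsum_nonneg fun k => b_nonneg _ (mul_nonneg (hlp k).le hw)
  · intro x hx y hy w hw
    have hw0 : 0 ≤ w := (abs_nonneg _).trans hw
    dsimp only
    rw [(b_sum w hw0).tsum_eq_zero_add]
    have : ∀ k : ℕ, l ^ k * (l * w) = l ^ (k + 1) * w := fun k => by ring
    simp only [this, pow_zero, one_mul]
    linarith [b_mod x hx y hy w hw]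
  · intro ε hε
    have ht := tendsto_sum_nat_add fun n : ℕ => 2 * β (l ^ n)
    obtain ⟨m, hm⟩ := (ht.eventually (gt_mem_nhds hε)).exists
    refine ⟨l ^ m, hlp m, fun w hw hwm => ?_⟩
    refine le_trans ?_ hm.le
    refine Summable.tsum_le_tsum (fun k => ?_) (b_sum w hw)
      ((summable_nat_add_iff m).2 (hs.mul_left 2))
    have h1 : l ^ k * w ≤ l ^ (k + m) := by
      rw [pow_add]; exact mul_le_mul_of_nonneg_left hwm.le (hlp k).le
    refine (b_mono _ _ (mul_nonneg (hlp k).le hw) h1).trans ?_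
    refine (b_le _ (hlp _).le (k + m)).trans (le_of_eq ?_)
    rw [div_self (hlp _).ne']
    ring

/-- Equicontinuity of the dual iterates from a geometric contraction of weighted distances. -/
lemma dual_iterates_equicontinuous {X : Type*} {p : Bool → X → ℝ} {f : Bool → X → X} {s : X → ℝ}
    {ψ : ℕ → X → ℝ} {H u : ℝ → ℝ} {l r K L : ℝ}
    (hp0 : ∀ b x, 0 ≤ p b x) (hp1 : ∀ x, p false x + p true x = 1)
    (hψ : ∀ n x, ψ (n + 1) x = ∑ b, p b x * ψ n (f b x))
    (hK : ∀ n x, |ψ n x| ≤ K) (hL0 : 0 ≤ L) (hL : ∀ x y, |ψ 0 x - ψ 0 y| ≤ L * |s x - s y|)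
    (hne : ∀ b x y, |s (f b x) - s (f b y)| ≤ |s x - s y|)
    (hr : 0 < r) (hu : ∀ m, 0 ≤ m → 1 ≤ u m)
    (hW : ∀ x y, |s x - s y| ≤ r →
      ∑ b, p b x * (|s (f b x) - s (f b y)| * u |s (f b x)|) ≤ l * (|s x - s y| * u |s x|))
    (hHc : ConcaveOn ℝ (Ici 0) H) (hHm : MonotoneOn H (Ici 0)) (hHnn : ∀ w, 0 ≤ w → 0 ≤ H w)
    (hl0 : 0 ≤ l)
    (hH : ∀ x y w, |s x - s y| ≤ w → H (l * w) + |p false x - p false y| ≤ H w)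
    (hH0 : ∀ ε, 0 < ε → ∃ δ, 0 < δ ∧ ∀ w, 0 ≤ w → w < δ → H w ≤ ε)
    (x : X) {ε : ℝ} (hε : 0 < ε) :
    ∃ δ, 0 < δ ∧ ∀ y, |s x - s y| < δ → ∀ n, |ψ n x - ψ n y| ≤ ε := by
  have hK0 : 0 ≤ K := (abs_nonneg _).trans (hK 0 x)
  have hu0 : ∀ m, 0 ≤ m → 0 ≤ u m := fun m hm => zero_le_one.trans (hu m hm)
  have main : ∀ n x y, |s x - s y| ≤ r →
      |ψ n x - ψ n y| ≤ 2 * K * H (|s x - s y| * u |s x|) + L * |s x - s y| := by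
    intro n
    induction n with
    | zero =>
      intro x y hxy
      have hw : 0 ≤ |s x - s y| * u |s x| := mul_nonneg (abs_nonneg _) (hu0 _ (abs_nonneg _))
      have := mul_nonneg (by positivity : 0 ≤ 2 * K) (hHnn _ hw)
      linarith [hL x y]
    | succ n ih =>
      intro x y hxy
      set d := |s x - s y| with hd
      set w := d * u |s x| with hw
      set wb : Bool → ℝ := fun b => |s (f b x) - s (f b y)| * u |s (f b x)| with hwb
      have hwb0 : ∀ b, 0 ≤ wb b := fun b => mul_nonneg (abs_nonneg _) (hu0 _ (abs_nonneg _))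
      have hdw : d ≤ w := le_mul_of_one_le_right (abs_nonneg _) (hu _ (abs_nonneg _))
      have hw0 : 0 ≤ w := (abs_nonneg _).trans hdw
      have hstep : ∀ b, |ψ n (f b x) - ψ n (f b y)| ≤ 2 * K * H (wb b) + L * d := fun b =>
        (ih (f b x) (f b y) ((hne b x y).trans hxy)).trans
          (by simp only [hwb]; gcongr; exact hne b x y)
      have hsplit : ψ (n + 1) x - ψ (n + 1) y =
          p false x * (ψ n (f false x) - ψ n (f false y)) +
          p true x * (ψ n (f true x) - ψ n (f true y)) +
          (p false x - p false y) * (ψ n (f false y) - ψ n (f true y)) := by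
        rw [hψ, hψ, Fintype.sum_bool, Fintype.sum_bool]
        have h1 : p true x = 1 - p false x := by linarith [hp1 x]
        have h2 : p true y = 1 - p false y := by linarith [hp1 y]
        rw [h1, h2]; ring
      have hosc : |ψ n (f false y) - ψ n (f true y)| ≤ 2 * K := by
        have := abs_sub (ψ n (f false y)) (ψ n (f true y))
        linarith [hK n (f false y), hK n (f true y)]
      have hJ : p false x * H (wb false) + p true x * H (wb true) ≤ H (l * w) := by
        have h1 := hHc.2 (hwb0 false : wb false ∈ Ici 0) (hwb0 true : wb true ∈ Ici 0)
          (hp0 false x) (hp0 true x) (hp1 x)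
        simp only [smul_eq_mul] at h1
        refine h1.trans (hHm ?_ ?_ ?_)
        · exact add_nonneg (mul_nonneg (hp0 _ _) (hwb0 _)) (mul_nonneg (hp0 _ _) (hwb0 _))
        · exact mul_nonneg hl0 hw0
        · have := hW x y hxy
          rw [Fintype.sum_bool] at this
          simp only [hwb]
          linarith
      have hHw := hH x y w hdw
      rw [hsplit]
      refine (abs_add_three _ _ _).trans ?_
      rw [abs_mul, abs_mul, abs_mul, abs_of_nonneg (hp0 false x), abs_of_nonneg (hp0 true x)]
      calc _ ≤ p false x * (2 * K * H (wb false) + L * d) +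
            p true x * (2 * K * H (wb true) + L * d) +
            |p false x - p false y| * (2 * K) :=
            add_le_add (add_le_add (mul_le_mul_of_nonneg_left (hstep _) (hp0 _ _))
              (mul_le_mul_of_nonneg_left (hstep _) (hp0 _ _)))
              (mul_le_mul_of_nonneg_left hosc (abs_nonneg _))
        _ = 2 * K * ((p false x * H (wb false) + p true x * H (wb true)) +
            |p false x - p false y|) + L * d := by
            have h1 : p true x = 1 - p false x := by linarith [hp1 x]
            rw [h1]; ring
        _ ≤ 2 * K * H w + L * d := by
            have : 0 ≤ 2 * K := by positivity
            gcongr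
            linarith
  have hε' : 0 < ε / (2 * (2 * K + 1)) := by positivity
  obtain ⟨δ, hδ, hHδ⟩ := hH0 _ hε'
  have hux : 0 < u |s x| := zero_lt_one.trans_le (hu _ (abs_nonneg _))
  refine ⟨min r (min (δ / u |s x|) (ε / (2 * (L + 1)))), by positivity, fun y hy n => ?_⟩
  rw [lt_min_iff, lt_min_iff] at hy
  obtain ⟨h1, h2, h3⟩ := hy
  rw [lt_div_iff₀ hux] at h2
  rw [lt_div_iff₀ (by positivity)] at h3
  have hw : 0 ≤ |s x - s y| * u |s x| := mul_nonneg (abs_nonneg _) hux.le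
  have h4 := hHδ _ hw h2
  rw [le_div_iff₀ (by positivity)] at h4
  have h5 := hHnn _ hw
  have h6 := abs_nonneg (s x - s y)
  have h7 := main n x y h1.le
  linarith

set_option maxHeartbeats 400000 in
/-- A weight for which the weighted distance contracts on average: distances never increase,
they contract in `2 * τ ≤ |s| ≤ a`, points leave `|s| < 2 * τ` at once, and outside these
regions there is a drift towards the centre. -/
lemma exists_contracting_weight {X : Type*} {p : Bool → X → ℝ} {f : Bool → X → X} {s : X → ℝ}
    {ρ τ a c α S γ l : ℝ} (hρ : 0 < ρ) (hp : ∀ b x, ρ ≤ p b x)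
    (hp1 : ∀ x, p false x + p true x = 1)
    (hne : ∀ b x y, |s (f b x) - s (f b y)| ≤ |s x - s y|)
    (hc1 : c < 1) (hα : 0 < α)
    (hγ : 0 < γ) (hl : l < 1)
    (hcentre : ∀ x, |s x| < 2 * τ → ∀ b, 2 * τ ≤ |s (f b x)| ∧ |s (f b x)| ≤ a)
    (hcontr : ∀ x, 2 * τ ≤ |s x| → |s x| ≤ a →
      ∃ b, ∀ y, |s x - s y| ≤ τ → |s (f b x) - s (f b y)| ≤ c * |s x - s y|)
    (hjump : ∀ b x, |s (f b x)| ≤ |s x| + α)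
    (hdrift : ∀ x, a < |s x| → ∃ b, |s (f b x)| ≤ |s x| - α)
    (hfar : ∀ x, S ≤ |s x| → ∑ b, p b x * Real.exp (γ * |s (f b x)|) ≤ l * Real.exp (γ * |s x|)) :
    ∃ (u : ℝ → ℝ) (l' : ℝ), 0 < l' ∧ l' < 1 ∧ (∀ m, 0 ≤ m → 1 ≤ u m) ∧
      ∀ x y, |s x - s y| ≤ τ →
        ∑ b, p b x * (|s (f b x) - s (f b y)| * u |s (f b x)|) ≤ l' * (|s x - s y| * u |s x|) := by
  obtain ⟨κ, hκ, hκρ⟩ : ∃ κ, 0 < κ ∧ 2 ≤ ρ * Real.exp (κ * α) := by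
    refine ⟨2 / ρ / α, by positivity, ?_⟩
    rw [div_mul_cancel₀ _ hα.ne']
    have h := Real.add_one_le_exp (2 / ρ)
    have h2 := mul_le_mul_of_nonneg_left h hρ.le
    have h3 : ρ * (2 / ρ + 1) = 2 + ρ := by field_simp
    linarith
  obtain ⟨η, hη, hηS⟩ : ∃ η, 0 < η ∧ η * Real.exp (γ * (S + α)) = Real.exp (-κ * S) / 2 := by
    refine ⟨Real.exp (-κ * S) / 2 / Real.exp (γ * (S + α)), by positivity, ?_⟩
    field_simp
  set T : ℝ → ℝ := fun m => 2 - Real.exp (-κ * m) + η * Real.exp (γ * m) with hT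
  have hTm : ∀ m n, m ≤ n → T m ≤ T n := by
    intro m n hmn
    have h1 : Real.exp (-κ * n) ≤ Real.exp (-κ * m) := Real.exp_le_exp.2 (by nlinarith)
    have h2 : η * Real.exp (γ * m) ≤ η * Real.exp (γ * n) := by gcongr
    simp only [hT]; linarith
  have hT1 : ∀ m, 0 ≤ m → 1 ≤ T m := by
    intro m hm
    have h1 : Real.exp (-κ * m) ≤ 1 := Real.exp_le_one_iff.2 (by nlinarith)
    have h2 : 0 < η * Real.exp (γ * m) := by positivity
    simp only [hT]; linarith
  set P : ℝ → ℝ := fun m => if m < 2 * τ then 1 else if m ≤ a then 0 else T m with hP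
  have hP0 : ∀ m, 0 ≤ m → 0 ≤ P m := by
    intro m hm
    have := hT1 m hm
    simp only [hP]; split_ifs <;> linarith
  have hPT : ∀ m, 0 ≤ m → P m ≤ T m := by
    intro m hm
    have := hT1 m hm
    simp only [hP]; split_ifs <;> linarith
  set M := max 1 (T (a + α)) with hM
  have hM0 : 0 < M := zero_lt_one.trans_le (le_max_left _ _)
  set z := ρ * (1 - c) with hz
  have hz0 : 0 < z := mul_pos hρ (by linarith)
  set δ := z / 2 / M with hδ
  have hδ0 : 0 < δ := by positivity
  have hδM : δ * M = z / 2 := by rw [hδ]; field_simp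
  set B := 1 + 2 * δ + δ * η with hB
  have hB0 : 0 < B := by positivity
  obtain ⟨ω, hω0, hω1, hωδ, hωz, hωS, hωf⟩ : ∃ ω : ℝ, 0 < ω ∧ ω ≤ 1 / 2 ∧ ω ≤ δ / (1 + δ) ∧
      ω ≤ z / 2 ∧ ω ≤ δ * (Real.exp (-κ * S) / 2) / (B * Real.exp (γ * S)) ∧
      ω ≤ δ * η * (1 - l) / B := by
    have h1l : 0 < 1 - l := by linarith
    refine ⟨min (1 / 2) (min (δ / (1 + δ)) (min (z / 2)
      (min (δ * (Real.exp (-κ * S) / 2) / (B * Real.exp (γ * S))) (δ * η * (1 - l) / B)))),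
      by positivity, ?_⟩
    simp only [min_le_iff, le_refl, true_or, or_true, and_self]
  have hsum : ∀ (b : Bool) (F : Bool → ℝ), ∑ b, F b = F b + F (!b) := by
    intro b F
    cases b <;> simp [add_comm]
  have hpos : ∀ b x, 0 ≤ p b x := fun b x => hρ.le.trans (hp b x)
  have hpsum : ∀ b x, p (!b) x = 1 - p b x := by
    intro b x
    cases b <;> simp <;> linarith [hp1 x]
  refine ⟨fun m => 1 + δ * P m, 1 - ω, by linarith, by linarith,
    fun m hm => by have := mul_nonneg hδ0.le (hP0 m hm); linarith, fun x y hxy => ?_⟩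
  have hd0 : 0 ≤ |s x - s y| := abs_nonneg _
  have hub : ∀ b, 0 ≤ 1 + δ * P |s (f b x)| := fun b => by
    have := mul_nonneg hδ0.le (hP0 _ (abs_nonneg (s (f b x)))); linarith
  -- it suffices to bound the averaged weight when no contraction is used
  have hred : ∑ b, p b x * (1 + δ * P |s (f b x)|) ≤ (1 - ω) * (1 + δ * P |s x|) →
      ∑ b, p b x * (|s (f b x) - s (f b y)| * (1 + δ * P |s (f b x)|)) ≤
        (1 - ω) * (|s x - s y| * (1 + δ * P |s x|)) := by
    intro h
    calc _ ≤ ∑ b, |s x - s y| * (p b x * (1 + δ * P |s (f b x)|)) := by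
          refine Finset.sum_le_sum fun b _ => ?_
          have h1 := mul_le_mul_of_nonneg_right (hne b x y) (hub b)
          have h2 := mul_le_mul_of_nonneg_left h1 (hpos b x)
          linarith
      _ ≤ |s x - s y| * ((1 - ω) * (1 + δ * P |s x|)) := by
          rw [← Finset.mul_sum]
          exact mul_le_mul_of_nonneg_left h hd0
      _ = _ := by ring
  rcases lt_or_ge |s x| (2 * τ) with h0 | h0
  · refine hred ?_
    have hPx : P |s x| = 1 := by simp only [hP, if_pos h0]
    have hPb : ∀ b, P |s (f b x)| = 0 := fun b => by
      obtain ⟨h1, h2⟩ := hcentre x h0 b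
      simp only [hP, if_neg (not_lt.2 h1), if_pos h2]
    rw [Fintype.sum_bool, hPx, hPb, hPb]
    rw [le_div_iff₀ (by positivity)] at hωδ
    linarith [hp1 x]
  rcases le_or_gt |s x| a with ha | ha
  · have hPx : P |s x| = 0 := by simp only [hP, if_neg (not_lt.2 h0), if_pos ha]
    have hPb : ∀ b, 1 + δ * P |s (f b x)| ≤ 1 + z / 2 := fun b => by
      have h1 := hjump b x
      have h2 : P |s (f b x)| ≤ M := by
        have := hTm |s (f b x)| (a + α) (by linarith)
        simp only [hP]
        split_ifs
        · exact le_max_left _ _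
        · exact hM0.le
        · exact this.trans (le_max_right _ _)
      have := mul_le_mul_of_nonneg_left h2 hδ0.le
      linarith
    obtain ⟨b, hb⟩ := hcontr x h0 ha
    have hby := hb y hxy
    beta_reduce
    rw [hPx, hsum b, hpsum]
    have hpb := hp b x
    have h1 : |s (f b x) - s (f b y)| * (1 + δ * P |s (f b x)|) ≤
        (c * |s x - s y|) * (1 + z / 2) :=
      mul_le_mul hby (hPb b) (hub b) ((abs_nonneg _).trans hby)
    have h2 : |s (f (!b) x) - s (f (!b) y)| * (1 + δ * P |s (f (!b) x)|) ≤
        |s x - s y| * (1 + z / 2) :=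
      mul_le_mul (hne _ x y) (hPb _) (hub _) hd0
    have h3 := mul_le_mul_of_nonneg_left h1 (hpos b x)
    have h4 := mul_le_mul_of_nonneg_left h2 (hpos (!b) x)
    rw [hpsum] at h4
    refine (add_le_add h3 h4).trans ?_
    have h5 : p b x * c + (1 - p b x) ≤ 1 - z := by
      have := mul_le_mul_of_nonneg_right hpb (by linarith : 0 ≤ 1 - c)
      rw [hz]; linarith
    have h6 : (p b x * c + (1 - p b x)) * (1 + z / 2) ≤ 1 - ω := by
      have := mul_le_mul_of_nonneg_right h5 (by linarith : 0 ≤ 1 + z / 2)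
      nlinarith
    have h7 := mul_le_mul_of_nonneg_left h6 hd0
    linarith
  · refine hred ?_
    have hPx : P |s x| = T |s x| := by
      simp only [hP, if_neg (not_lt.2 h0), if_neg (not_le.2 ha)]
    have hm0 := abs_nonneg (s x)
    set m := |s x| with hm
    set E := ∑ b, p b x * Real.exp (γ * |s (f b x)|) with hE
    have hPb : ∑ b, p b x * (1 + δ * P |s (f b x)|) ≤
        1 + δ * (2 - 2 * Real.exp (-κ * m) + η * E) := by
      obtain ⟨b, hb⟩ := hdrift x ha
      have h1 : ∀ b', p b' x * (1 + δ * P |s (f b' x)|) ≤ p b' x * (1 + δ * T |s (f b' x)|) :=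
        fun b' => by
          have := hPT _ (abs_nonneg (s (f b' x)))
          have := hpos b' x
          gcongr
      refine (Finset.sum_le_sum fun b' _ => h1 b').trans ?_
      have h2 : Real.exp (κ * α) * Real.exp (-κ * m) ≤ Real.exp (-κ * |s (f b x)|) := by
        rw [← Real.exp_add]
        exact Real.exp_le_exp.2 (by nlinarith)
      have h3 : 2 * Real.exp (-κ * m) ≤ p b x * Real.exp (-κ * |s (f b x)|) := by
        calc 2 * Real.exp (-κ * m) ≤ (ρ * Real.exp (κ * α)) * Real.exp (-κ * m) := by gcongr
          _ = ρ * (Real.exp (κ * α) * Real.exp (-κ * m)) := by ring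
          _ ≤ _ := mul_le_mul (hp b x) h2 (by positivity) (hpos b x)
      have h4 : 0 ≤ p (!b) x * Real.exp (-κ * |s (f (!b) x)|) :=
        mul_nonneg (hpos _ _) (Real.exp_pos _).le
      have h5 : ∑ b', p b' x * (1 + δ * T |s (f b' x)|) =
          1 + δ * (2 - (p b x * Real.exp (-κ * |s (f b x)|) +
            p (!b) x * Real.exp (-κ * |s (f (!b) x)|)) + η * E) := by
        rw [hE, hsum b, hsum b, hpsum]; simp only [hT]; ring
      rw [h5]
      gcongr
      linarith
    refine hPb.trans ?_
    rw [hPx]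
    have he1 : 1 ≤ Real.exp (γ * m) := Real.one_le_exp (by positivity)
    have hTB : 1 + δ * T m ≤ B * Real.exp (γ * m) := by
      have h1 : T m ≤ 2 * Real.exp (γ * m) + η * Real.exp (γ * m) := by
        have := Real.exp_pos (-κ * m)
        simp only [hT]; linarith
      have := mul_le_mul_of_nonneg_left h1 hδ0.le
      rw [hB]; linarith
    have hωT := mul_le_mul_of_nonneg_left hTB hω0.le
    suffices h : ω * (B * Real.exp (γ * m)) ≤
        δ * (Real.exp (-κ * m) + η * Real.exp (γ * m) - η * E) by
      have : T m = 2 - Real.exp (-κ * m) + η * Real.exp (γ * m) := rfl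
      rw [this] at hωT ⊢
      linarith
    rcases le_total S m with hS | hS
    · have h1 := mul_le_mul_of_nonneg_left (hfar x hS) hη.le
      rw [le_div_iff₀ hB0] at hωf
      have h2 := mul_le_mul_of_nonneg_right hωf (Real.exp_pos (γ * m)).le
      have h3 := mul_pos hδ0 (Real.exp_pos (-κ * m))
      have h4 := mul_le_mul_of_nonneg_left h1 hδ0.le
      simp only [← hm, ← hE] at h4
      linarith
    · have hES : E ≤ Real.exp (γ * (S + α)) := by
        have h1 : ∀ b, p b x * Real.exp (γ * |s (f b x)|) ≤ p b x * Real.exp (γ * (S + α)) :=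
          fun b => mul_le_mul_of_nonneg_left
            (Real.exp_le_exp.2 (mul_le_mul_of_nonneg_left (by linarith [hjump b x]) hγ.le))
            (hpos b x)
        refine (Finset.sum_le_sum fun b _ => h1 b).trans (le_of_eq ?_)
        rw [← Finset.sum_mul, Fintype.sum_bool, add_comm, hp1, one_mul]
      have h1 : Real.exp (-κ * S) ≤ Real.exp (-κ * m) :=
        Real.exp_le_exp.2 (mul_le_mul_of_nonpos_left hS (by linarith))
      have h2 : Real.exp (γ * m) ≤ Real.exp (γ * S) :=
        Real.exp_le_exp.2 (mul_le_mul_of_nonneg_left hS hγ.le)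
      rw [le_div_iff₀ (by positivity)] at hωS
      have h3 : ω * (B * Real.exp (γ * m)) ≤ ω * (B * Real.exp (γ * S)) := by gcongr
      refine (h3.trans hωS).trans (mul_le_mul_of_nonneg_left ?_ hδ0.le)
      have h4 := mul_le_mul_of_nonneg_left hES hη.le
      have h5 : 0 < η * Real.exp (γ * m) := by positivity
      linarith

/-- A Harris type theorem: for a positive unital operator `Q` with a Lyapunov function `V`, a
bounded sequence with `D (n + 1) ≤ Q (D n)` tends to zero if from each sublevel set of `V` one
reaches, with probability bounded below, points at which all `D n` are small. -/
lemma tendsto_zero_of_lyapunov {Z : Type*} (Q : (Z → ℝ) →ₗ[ℝ] (Z → ℝ)) {V : Z → ℝ}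
    {D : ℕ → Z → ℝ} {l C K : ℝ} (hQ : ∀ χ : Z → ℝ, 0 ≤ χ → 0 ≤ Q χ) (hQ1 : Q 1 = 1)
    (hV : 0 ≤ V) (hl0 : 0 ≤ l) (hl1 : l < 1) (hQV : ∀ z, Q V z ≤ l * V z + C) (hC : 0 ≤ C)
    (hD0 : ∀ n, 0 ≤ D n) (hDK : ∀ n z, D n z ≤ K) (hDQ : ∀ n, D (n + 1) ≤ Q (D n))
    (hreach : ∀ R ε, 0 < ε → ∃ N : ℕ, 1 ≤ N ∧ ∃ ρ > 0, ∀ z, V z ≤ R →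
      ∃ z', (∀ χ : Z → ℝ, 0 ≤ χ → ρ * χ z' ≤ (Q ^ N) χ z) ∧ ∀ n, D n z' ≤ ε) (z : Z) :
    Tendsto (fun n => D n z) atTop (𝓝 0) := by
  have hmono : ∀ N χ₁ χ₂, χ₁ ≤ χ₂ → (Q ^ N) χ₁ ≤ (Q ^ N) χ₂ := by
    intro N
    induction N with
    | zero => intro χ₁ χ₂ h; simpa using h
    | succ N ih =>
      intro χ₁ χ₂ h
      rw [pow_succ, Module.End.mul_apply, Module.End.mul_apply]
      refine ih _ _ ?_
      have := hQ (χ₂ - χ₁) (sub_nonneg.2 h)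
      rwa [map_sub, sub_nonneg] at this
  have hone : ∀ N, (Q ^ N) 1 = 1 := by
    intro N
    induction N with
    | zero => simp
    | succ N ih => rw [pow_succ, Module.End.mul_apply, hQ1, ih]
  have hDN : ∀ N n, D (n + N) ≤ (Q ^ N) (D n) := by
    intro N
    induction N with
    | zero => intro n; simp
    | succ N ih =>
      intro n
      rw [pow_succ, Module.End.mul_apply]
      calc D (n + (N + 1)) = D (n + 1 + N) := by congr 1; ring
        _ ≤ (Q ^ N) (D (n + 1)) := ih (n + 1)
        _ ≤ _ := hmono N _ _ (hDQ n)
  set C' := C / (1 - l) + 1 with hC'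
  have h1l : 0 < 1 - l := by linarith
  have hC'1 : 1 ≤ C' := by have : 0 ≤ C / (1 - l) := by positivity
                           linarith
  have hC'l : C ≤ (1 - l) * C' := by
    rw [hC', mul_add, mul_div_cancel₀ _ h1l.ne']; linarith
  have hVN : ∀ N, ∀ z, (Q ^ (N + 1)) V z ≤ l * V z + C' := by
    have aux : ∀ N, ∀ z, (Q ^ N) V z ≤ l ^ N * V z + C' := by
      intro N
      induction N with
      | zero => intro z; simp; linarith
      | succ N ih =>
        intro z
        rw [pow_succ, Module.End.mul_apply]
        have h1 : Q V ≤ l • V + C • (1 : Z → ℝ) := fun z => by simpa using hQV z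
        have h2 := hmono N _ _ h1 z
        rw [map_add, map_smul, map_smul, hone] at h2
        simp only [Pi.add_apply, Pi.smul_apply, smul_eq_mul, Pi.one_apply, mul_one] at h2
        have h3 := mul_le_mul_of_nonneg_left (ih z) hl0
        rw [pow_succ]
        linarith
    intro N z
    have := aux (N + 1) z
    have h3 : l ^ (N + 1) ≤ l := by
      simpa using pow_le_pow_of_le_one hl0 hl1.le (by omega : 1 ≤ N + 1)
    have := mul_le_mul_of_nonneg_right h3 (hV z)
    linarith
  have hK0 : 0 ≤ K := (hD0 0 z).trans (hDK 0 z)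
  have key : ∀ ε, 0 < ε → ∃ k θ : ℝ, ∃ N : ℕ, 0 ≤ k ∧ k < 1 ∧ 1 ≤ N ∧
      ∀ j n, j * N ≤ n → ∀ z, D n z ≤ ε + K * k ^ j * (1 + θ * V z) := by
    intro ε hε
    set R := 2 * C' / (1 - l) with hR
    have hR0 : 0 < R := by positivity
    have hRC : (1 - l) * R = 2 * C' := by rw [hR, mul_div_cancel₀ _ h1l.ne']
    obtain ⟨N, hN, ρ, hρ, hstep⟩ := hreach R ε hε
    set θ := ρ / (2 * C') with hθ
    have hθ0 : 0 < θ := by positivity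
    have hθC : θ * C' = ρ / 2 := by rw [hθ]; field_simp
    have hθR : 0 < θ * R := by positivity
    set k₁ := (1 + θ * R * ((1 + l) / 2)) / (1 + θ * R) with hk₁
    have hk₁1 : k₁ < 1 := by
      rw [hk₁, div_lt_one (by positivity)]
      have : θ * R * ((1 + l) / 2) < θ * R * 1 := by gcongr; linarith
      linarith
    have hk₁R : k₁ * (1 + θ * R) = 1 + θ * R * ((1 + l) / 2) := by rw [hk₁]; field_simp
    have hk₁0 : 0 ≤ k₁ := by positivity
    set k := max k₁ (max (1 - ρ / 2) l) with hk
    have hkk₁ : k₁ ≤ k := le_max_left _ _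
    have hkρ : 1 - ρ / 2 ≤ k := (le_max_left _ _).trans (le_max_right _ _)
    have hkl : l ≤ k := (le_max_right _ _).trans (le_max_right _ _)
    refine ⟨k, θ, N, hk₁0.trans hkk₁, max_lt hk₁1 (max_lt (by linarith) hl1), hN, ?_⟩
    intro j
    induction j with
    | zero =>
      intro n _ z
      have h1 : 0 ≤ K * (θ * V z) := mul_nonneg hK0 (mul_nonneg hθ0.le (hV z))
      have := hDK n z
      simp only [pow_zero, mul_one]
      linarith
    | succ j ih =>
      intro n hn z
      obtain ⟨m, rfl⟩ : ∃ m, n = m + N := ⟨n - N, by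
        have : N ≤ n := le_trans (by nlinarith) hn
        omega⟩
      have hm : j * N ≤ m := by
        have : (j + 1) * N = j * N + N := by ring
        omega
      set B := K * k ^ j with hB
      have hB0 : 0 ≤ B := mul_nonneg hK0 (pow_nonneg (hk₁0.trans hkk₁) j)
      have hBk : K * k ^ (j + 1) = B * k := by rw [hB]; ring
      set χ : Z → ℝ := (ε + B) • (1 : Z → ℝ) + (B * θ) • V - D m with hχ
      have hχa : ∀ z, χ z = ε + B + B * θ * V z - D m z := fun z => by simp [hχ]
      have hχ0 : 0 ≤ χ := fun z => by
        rw [hχa]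
        have := ih m hm z
        simp only [Pi.zero_apply]
        linarith
      have hQχ : (Q ^ N) χ z = ε + B + B * θ * (Q ^ N) V z - (Q ^ N) (D m) z := by
        rw [hχ, map_sub, map_add, map_smul, map_smul, hone]; simp
      have hDm := hDN N m z
      have hVz : (Q ^ N) V z ≤ l * V z + C' := by
        obtain ⟨N', rfl⟩ : ∃ N', N = N' + 1 := ⟨N - 1, by omega⟩
        exact hVN N' z
      have hVz' := mul_le_mul_of_nonneg_left hVz hθ0.le
      have hθV : 0 ≤ θ * V z := mul_nonneg hθ0.le (hV z)
      rw [hBk]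
      rcases le_or_gt (V z) R with hz | hz
      · obtain ⟨z', h1, h2⟩ := hstep z hz
        have h3 := h1 χ hχ0
        have h4 : B ≤ χ z' := by
          have h5 : 0 ≤ B * (θ * V z') := mul_nonneg hB0 (mul_nonneg hθ0.le (hV z'))
          have := h2 m
          rw [hχa]
          linarith
        have h5 := mul_le_mul_of_nonneg_left h4 hρ.le
        have h6 : 1 + θ * (Q ^ N) V z - ρ ≤ k * (1 + θ * V z) := by
          have := mul_le_mul_of_nonneg_right hkl hθV
          linarith
        have h7 := mul_le_mul_of_nonneg_left h6 hB0
        linarith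
      · have h3 : 0 ≤ (Q ^ N) χ z := by
          have := hmono N 0 χ hχ0 z
          rwa [map_zero] at this
        have h6 : 1 + θ * (Q ^ N) V z ≤ k * (1 + θ * V z) := by
          have e1 : C' ≤ (1 - l) / 2 * V z := by
            have : (1 - l) / 2 * R ≤ (1 - l) / 2 * V z := by gcongr
            linarith
          have e2 : 1 + θ * V z * ((1 + l) / 2) ≤ k₁ * (1 + θ * V z) := by
            have e3 : (1 + l) / 2 ≤ k₁ := by
              rw [hk₁, le_div_iff₀ (by positivity)]
              linarith
            have e4 : θ * R ≤ θ * V z := by gcongr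
            have := mul_le_mul_of_nonneg_right e3 (sub_nonneg.2 e4)
            linarith
          have e5 := mul_le_mul_of_nonneg_right hkk₁ (by linarith : 0 ≤ 1 + θ * V z)
          have e6 := mul_le_mul_of_nonneg_left e1 hθ0.le
          linarith
        have h7 := mul_le_mul_of_nonneg_left h6 hB0
        linarith
  rw [Metric.tendsto_atTop]
  intro ε hε
  obtain ⟨k, θ, N, hk0, hk1, hN, hb⟩ := key (ε / 2) (by positivity)
  have hlim : Tendsto (fun j : ℕ => K * k ^ j * (1 + θ * V z)) atTop (𝓝 0) := by
    simpa using ((tendsto_pow_atTop_nhds_zero_of_lt_one hk0 hk1).const_mul K).mul_const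
      (1 + θ * V z)
  obtain ⟨j, hj⟩ := (hlim.eventually (gt_mem_nhds (half_pos hε))).exists
  refine ⟨j * N, fun n hn => ?_⟩
  rw [Real.dist_eq, sub_zero, abs_of_nonneg (hD0 n z)]
  linarith [hb j n hn z]

/-- The transition operator of two independent copies of the Markov chain that moves from `x` to
`f b x` with probability `p b x`. -/
def pairOperator {X : Type*} (p : Bool → X → ℝ) (f : Bool → X → X) :
    (X × X → ℝ) →ₗ[ℝ] (X × X → ℝ) where
  toFun χ z := ∑ i, ∑ j, p i z.1 * p j z.2 * χ (f i z.1, f j z.2)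
  map_add' χ₁ χ₂ := by
    ext z
    simp only [Pi.add_apply, mul_add, Finset.sum_add_distrib]
  map_smul' a χ := by
    ext z
    simp only [Pi.smul_apply, smul_eq_mul, RingHom.id_apply, Finset.mul_sum]
    exact Finset.sum_congr rfl fun i _ => Finset.sum_congr rfl fun j _ => by ring

lemma pairOperator_apply {X : Type*} (p : Bool → X → ℝ) (f : Bool → X → X) (χ : X × X → ℝ)
    (x y : X) : pairOperator p f χ (x, y) = ∑ i, ∑ j, p i x * p j y * χ (f i x, f j y) := rfl

section Pair

variable {X : Type*} {p : Bool → X → ℝ} {f : Bool → X → X} {ρ : ℝ}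

lemma pairOperator_nonneg (hp : ∀ b x, 0 ≤ p b x) {χ : X × X → ℝ} (hχ : 0 ≤ χ) :
    0 ≤ pairOperator p f χ := by
  rintro ⟨x, y⟩
  rw [pairOperator_apply]
  exact Finset.sum_nonneg fun i _ => Finset.sum_nonneg fun j _ =>
    mul_nonneg (mul_nonneg (hp i _) (hp j _)) (hχ _)

lemma le_pairOperator (hρ : 0 ≤ ρ) (hp : ∀ b x, ρ ≤ p b x) {χ : X × X → ℝ} (hχ : 0 ≤ χ)
    (b : Bool) (x y : X) : ρ * ρ * χ (f b x, f b y) ≤ pairOperator p f χ (x, y) := by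
  have hp0 : ∀ b x, 0 ≤ p b x := fun b x => hρ.trans (hp b x)
  have hterm : ∀ i j, 0 ≤ p i x * p j y * χ (f i x, f j y) := fun i j =>
    mul_nonneg (mul_nonneg (hp0 i _) (hp0 j _)) (hχ _)
  calc ρ * ρ * χ (f b x, f b y) ≤ p b x * p b y * χ (f b x, f b y) :=
        mul_le_mul_of_nonneg_right (mul_le_mul (hp b x) (hp b y) hρ (hp0 b x)) (hχ _)
    _ ≤ ∑ j, p b x * p j y * χ (f b x, f j y) :=
        Finset.single_le_sum (f := fun j => p b x * p j y * χ (f b x, f j y))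
          (fun j _ => hterm b j) (Finset.mem_univ b)
    _ ≤ _ := Finset.single_le_sum (f := fun i => ∑ j, p i x * p j y * χ (f i x, f j y))
          (fun i _ => Finset.sum_nonneg fun j _ => hterm i j) (Finset.mem_univ b)

lemma le_pairOperator_pow (hρ : 0 ≤ ρ) (hp : ∀ b x, ρ ≤ p b x) (k : ℕ) {χ : X × X → ℝ}
    (hχ : 0 ≤ χ) (x y : X) :
    (ρ ^ 4) ^ k * χ ((fun x => f false (f true x))^[k] x, (fun x => f false (f true x))^[k] y) ≤
      (pairOperator p f ^ (2 * k)) χ (x, y) := by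
  have hp0 : ∀ b x, 0 ≤ p b x := fun b x => hρ.trans (hp b x)
  induction k generalizing x y with
  | zero => simp
  | succ k ih =>
    have hpow : 0 ≤ (pairOperator p f ^ (2 * k)) χ := by
      induction (2 * k) with
      | zero => simpa using hχ
      | succ n ihn =>
        rw [pow_succ', Module.End.mul_apply]
        exact pairOperator_nonneg hp0 ihn
    have h1 : 2 * (k + 1) = 2 * k + 1 + 1 := by ring
    rw [h1, pow_succ' (pairOperator p f), pow_succ' (pairOperator p f), Module.End.mul_apply,
      Module.End.mul_apply, Function.iterate_succ_apply, Function.iterate_succ_apply]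
    have h2 := le_pairOperator (f := f) hρ hp (pairOperator_nonneg (f := f) hp0 hpow) true x y
    have h3 := le_pairOperator (f := f) hρ hp hpow false (f true x) (f true y)
    have h4 := ih (f false (f true x)) (f false (f true y))
    have hρ2 : 0 ≤ ρ * ρ := mul_nonneg hρ hρ
    refine le_trans ?_ h2
    refine le_trans ?_ (mul_le_mul_of_nonneg_left h3 hρ2)
    refine le_trans (le_of_eq ?_)
      (mul_le_mul_of_nonneg_left (mul_le_mul_of_nonneg_left h4 hρ2) hρ2)
    ring

/-- Dual iterates of two points become equal asymptotically, if there is a Lyapunov function `v`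
and the orbits of `f₀ ∘ f₁` carry sublevel sets of `v` to where all the dual iterates are close
to their values at one point. -/
lemma dual_iterates_tendsto {ψ : ℕ → X → ℝ} {v : X → ℝ} {l C K : ℝ} (hρ : 0 < ρ)
    (hp : ∀ b x, ρ ≤ p b x) (hp1 : ∀ x, p false x + p true x = 1)
    (hψ : ∀ n x, ψ (n + 1) x = ∑ b, p b x * ψ n (f b x)) (hK : ∀ n x, |ψ n x| ≤ K)
    (hv : ∀ x, 0 ≤ v x) (hl0 : 0 ≤ l) (hl1 : l < 1) (hC : 0 ≤ C)
    (hdrift : ∀ x, ∑ b, p b x * v (f b x) ≤ l * v x + C) (c : X)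
    (hsteer : ∀ R ε, 0 < ε → ∃ k : ℕ, 1 ≤ k ∧ ∀ x, v x ≤ R →
      ∀ n, |ψ n c - ψ n ((fun x => f false (f true x))^[k] x)| ≤ ε) (x y : X) :
    Tendsto (fun n => |ψ n x - ψ n y|) atTop (𝓝 0) := by
  have hp0 : ∀ b x, 0 ≤ p b x := fun b x => hρ.le.trans (hp b x)
  have hpt : ∀ x, p true x = 1 - p false x := fun x => by linarith [hp1 x]
  refine tendsto_zero_of_lyapunov (pairOperator p f) (V := fun z => v z.1 + v z.2)
    (D := fun n z => |ψ n z.1 - ψ n z.2|) (l := l) (C := 2 * C) (K := 2 * K)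
    (fun χ hχ => pairOperator_nonneg hp0 hχ) ?_ (fun z => add_nonneg (hv _) (hv _)) hl0 hl1 ?_
    (by positivity) (fun n z => abs_nonneg _) ?_ ?_ ?_ (x, y)
  · ext ⟨x, y⟩
    simp only [pairOperator_apply, Fintype.sum_bool, hpt, Pi.one_apply]
    ring
  · rintro ⟨x, y⟩
    have h1 := hdrift x
    have h2 := hdrift y
    simp only [pairOperator_apply, Fintype.sum_bool, hpt] at h1 h2 ⊢
    linarith
  · rintro n ⟨x, y⟩
    have := abs_sub (ψ n x) (ψ n y)
    dsimp only
    linarith [hK n x, hK n y]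
  · rintro n ⟨x, y⟩
    rw [pairOperator_apply]
    have : ψ (n + 1) x - ψ (n + 1) y =
        ∑ i, ∑ j, p i x * p j y * (ψ n (f i x) - ψ n (f j y)) := by
      rw [hψ, hψ]
      simp only [Fintype.sum_bool, hpt]
      ring
    dsimp only
    rw [this]
    refine (Finset.abs_sum_le_sum_abs _ _).trans (Finset.sum_le_sum fun i _ => ?_)
    refine (Finset.abs_sum_le_sum_abs _ _).trans (Finset.sum_le_sum fun j _ => ?_)
    rw [abs_mul, abs_of_nonneg (mul_nonneg (hp0 i x) (hp0 j y))]
  · intro R ε hε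
    obtain ⟨k, hk, hsk⟩ := hsteer R (ε / 2) (by positivity)
    refine ⟨2 * k, by omega, (ρ ^ 4) ^ k, by positivity, ?_⟩
    rintro ⟨x, y⟩ hxy
    refine ⟨_, fun χ hχ => le_pairOperator_pow hρ.le hp k hχ x y, fun n => ?_⟩
    have h1 := hsk x (by linarith [hv y]) n
    have h2 := hsk y (by linarith [hv x]) n
    rw [abs_sub_comm] at h1
    have := abs_sub_le (ψ n ((fun x => f false (f true x))^[k] x)) (ψ n c)
      (ψ n ((fun x => f false (f true x))^[k] y))
    dsimp only
    linarith

end Pair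

namespace AM

/-- The coordinate `log (2 x)` near `0`, extended symmetrically, which maps `(0,1)` onto `ℝ`. -/
noncomputable def coord (x : ℝ) : ℝ :=
  if x ≤ 1 / 2 then Real.log (2 * x) else -Real.log (2 * (1 - x))

lemma coord_of_le {x : ℝ} (h : x ≤ 1 / 2) : coord x = Real.log (2 * x) := if_pos h

lemma coord_of_ge {x : ℝ} (h : 1 / 2 ≤ x) : coord x = -Real.log (2 * (1 - x)) := by
  rcases h.eq_or_lt with rfl | h
  · norm_num [coord]
  · exact if_neg (not_le.2 h)

lemma coord_one_sub (x : ℝ) : coord (1 - x) = -coord x := by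
  rcases le_total x (1 / 2) with h | h
  · rw [coord_of_le h, coord_of_ge (by linarith)]; ring_nf
  · rw [coord_of_ge h, coord_of_le (by linarith)]; ring_nf

lemma coord_half : coord (1 / 2) = 0 := by norm_num [coord]

lemma sub_le_coord_sub {x y : ℝ} (hx : 0 < x) (hy : y < 1) (hxy : x ≤ y) :
    y - x ≤ coord y - coord x := by
  have left : ∀ x y : ℝ, 0 < x → y ≤ 1 / 2 → x ≤ y → y - x ≤ coord y - coord x := by
    intro x y hx hy hxy
    have hy0 : 0 < y := hx.trans_le hxy
    rw [coord_of_le hy, coord_of_le (hxy.trans hy), ← Real.log_div (by positivity) (by positivity)]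
    have h := Real.one_sub_inv_le_log_of_pos (x := 2 * y / (2 * x)) (by positivity)
    refine le_trans ?_ h
    have : 1 - (2 * y / (2 * x))⁻¹ = (y - x) / y := by field_simp
    rw [this, le_div_iff₀ hy0]
    nlinarith
  have right : ∀ x y : ℝ, 1 / 2 ≤ x → y < 1 → x ≤ y → y - x ≤ coord y - coord x := by
    intro x y hx hy hxy
    have := left (1 - y) (1 - x) (by linarith) (by linarith) (by linarith)
    rw [coord_one_sub, coord_one_sub] at this
    linarith
  rcases le_total y (1 / 2) with h | h
  · exact left x y hx h hxy
  rcases le_total x (1 / 2) with h' | h'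
  · linarith [left x (1 / 2) hx le_rfl h', right (1 / 2) y le_rfl hy h]
  · exact right x y h' hy hxy

lemma abs_sub_le_abs_coord_sub {x y : ℝ} (hx : x ∈ Ioo (0:ℝ) 1) (hy : y ∈ Ioo (0:ℝ) 1) :
    |x - y| ≤ |coord x - coord y| := by
  rcases le_total x y with h | h
  · rw [abs_sub_comm, abs_sub_comm (coord x)]
    exact abs_le_abs_of_nonneg (by linarith) (sub_le_coord_sub hx.1 hy.2 h)
  · exact abs_le_abs_of_nonneg (by linarith) (sub_le_coord_sub hy.1 hx.2 h)

lemma coord_strictMono {x y : ℝ} (hx : 0 < x) (hy : y < 1) (hxy : x < y) : coord x < coord y := by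
  linarith [sub_le_coord_sub hx hy hxy.le]

lemma le_of_coord_le {x y : ℝ} (hx : x < 1) (hy : 0 < y) (h : coord x ≤ coord y) : x ≤ y := by
  by_contra! hyx
  linarith [coord_strictMono hy hx hyx]

section Maps

variable {x₀ y₀ : ℝ}

lemma f0_of_le {x : ℝ} (h : x ≤ x₀) : f0 x₀ y₀ x = (y₀ / x₀) * x := if_pos h

lemma f0_of_ge (hA : A1 x₀ y₀) {x : ℝ} (h : x₀ ≤ x) :
    f0 x₀ y₀ x = 1 - (1 - y₀) / (1 - x₀) * (1 - x) := by
  obtain ⟨h1, h2, h3, h4⟩ := hA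
  rcases h.eq_or_lt with rfl | h
  · rw [f0_of_le le_rfl]
    have : 1 - x₀ ≠ 0 := by linarith
    have : x₀ ≠ 0 := by linarith
    field_simp
    ring
  · rw [f0, if_neg (not_le.2 h)]; ring

lemma f0_strictMono (hA : A1 x₀ y₀) : StrictMono (f0 x₀ y₀) := by
  have hA' := hA
  obtain ⟨h1, h2, h3, h4⟩ := hA'
  have ha0 : 0 < y₀ / x₀ := div_pos (by linarith) (by linarith)
  have ha1 : 0 < (1 - y₀) / (1 - x₀) := div_pos (by linarith) (by linarith)
  have e1 : StrictMonoOn (f0 x₀ y₀) (Iic x₀) := by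
    intro x hx y hy hxy
    rw [f0_of_le hx, f0_of_le hy]
    exact mul_lt_mul_of_pos_left hxy ha0
  have e2 : StrictMonoOn (f0 x₀ y₀) (Ici x₀) := by
    intro x hx y hy hxy
    rw [f0_of_ge hA hx, f0_of_ge hA hy]
    have := mul_lt_mul_of_pos_left hxy ha1
    linarith
  exact e1.Iic_union_Ici e2

lemma f0_mem (hA : A1 x₀ y₀) {x : ℝ} (hx : x ∈ Ioo (0:ℝ) 1) : f0 x₀ y₀ x ∈ Ioo (0:ℝ) 1 := by
  have hA' := hA
  obtain ⟨h1, h2, h3, h4⟩ := hA'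
  have e0 : f0 x₀ y₀ 0 = 0 := by rw [f0_of_le (by linarith)]; simp
  have e1 : f0 x₀ y₀ 1 = 1 := by rw [f0_of_ge hA h2.le]; simp
  constructor
  · rw [← e0]; exact f0_strictMono hA hx.1
  · rw [← e1]; exact f0_strictMono hA hx.2

lemma one_sub_mem {x : ℝ} (hx : x ∈ Ioo (0:ℝ) 1) : 1 - x ∈ Ioo (0:ℝ) 1 :=
  ⟨by linarith [hx.2], by linarith [hx.1]⟩

lemma f1_mem (hA : A1 x₀ y₀) {x : ℝ} (hx : x ∈ Ioo (0:ℝ) 1) : f1 x₀ y₀ x ∈ Ioo (0:ℝ) 1 :=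
  one_sub_mem (f0_mem hA (one_sub_mem hx))

lemma fb_mem (hA : A1 x₀ y₀) (b : Bool) {x : ℝ} (hx : x ∈ Ioo (0:ℝ) 1) :
    fb x₀ y₀ b x ∈ Ioo (0:ℝ) 1 := by
  cases b
  · exact f0_mem hA hx
  · exact f1_mem hA hx

lemma coord_f1 (x : ℝ) : coord (f1 x₀ y₀ x) = -coord (f0 x₀ y₀ (1 - x)) := by
  rw [f1, coord_one_sub]

lemma coord_f0_of_le_half (hA : A1 x₀ y₀) {x : ℝ} (hx : 0 < x) (h : x ≤ 1 / 2) :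
    coord (f0 x₀ y₀ x) = coord x + Real.log (y₀ / x₀) := by
  obtain ⟨h1, h2, h3, h4⟩ := hA
  have ha0 : 0 < y₀ / x₀ := div_pos (by linarith) (by linarith)
  have ha0' : y₀ / x₀ < 1 := (div_lt_one (by linarith)).2 h4
  rw [f0_of_le (by linarith), coord_of_le h, coord_of_le (by nlinarith),
    ← Real.log_mul (by positivity) ha0.ne']
  ring_nf

lemma coord_f0_of_ge (hA : A1 x₀ y₀) {x : ℝ} (hx : x < 1) (h : x₀ ≤ x) :
    coord (f0 x₀ y₀ x) = coord x - Real.log ((1 - y₀) / (1 - x₀)) := by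
  have hf : f0 x₀ y₀ x₀ ≤ f0 x₀ y₀ x := (f0_strictMono hA).monotone h
  have hA' := hA
  obtain ⟨h1, h2, h3, h4⟩ := hA'
  have ha1 : 0 < (1 - y₀) / (1 - x₀) := div_pos (by linarith) (by linarith)
  rw [f0_of_le le_rfl, div_mul_cancel₀ _ (by linarith)] at hf
  rw [coord_of_ge (by linarith), coord_of_ge (by linarith), f0_of_ge hA h]
  have : 2 * (1 - (1 - (1 - y₀) / (1 - x₀) * (1 - x))) =
      (2 * (1 - x)) * ((1 - y₀) / (1 - x₀)) := by ring
  rw [this, Real.log_mul (by linarith) ha1.ne']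
  ring

/-- On the middle part `[1 / (1 + c), x₀]` the map `f₀` contracts `coord`-distances by `c`. -/
lemma coord_f0_sub_le (hA : A1 x₀ y₀) {c : ℝ} (hc : y₀ / x₀ ≤ c) (hc1 : c ≤ 1) {x y : ℝ}
    (hx : 1 / (1 + c) ≤ x) (hy : y ≤ x₀) (hxy : x ≤ y) :
    coord (f0 x₀ y₀ y) - coord (f0 x₀ y₀ x) ≤ c * (coord y - coord x) := by
  have hA' := hA
  obtain ⟨h1, h2, h3, h4⟩ := hA'
  set a := y₀ / x₀ with ha
  have ha0 : 0 < a := div_pos (by linarith) (by linarith)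
  have ha1 : a < 1 := (div_lt_one (by linarith)).2 h4
  have hax : a * x₀ = y₀ := div_mul_cancel₀ _ (by linarith)
  have hc0 : 0 < c := ha0.trans_le hc
  have hhalf : 1 / 2 ≤ 1 / (1 + c) := by gcongr; linarith
  have low : ∀ x y, 1 / (1 + c) ≤ x → y ≤ x₀ → x ≤ y → a * y ≤ 1 / 2 →
      coord (f0 x₀ y₀ y) - coord (f0 x₀ y₀ x) ≤ c * (coord y - coord x) := by
    intro x y hx hy hxy hay
    have hx0 : 0 < x := by linarith
    have hy0 : 0 < y := by linarith
    have hxc : 1 - x ≤ c * x := by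
      rw [div_le_iff₀ (by linarith)] at hx; linarith
    rw [f0_of_le hy, f0_of_le (hxy.trans hy), coord_of_le hay, coord_of_le (by nlinarith),
      coord_of_ge (by linarith), coord_of_ge (by linarith)]
    have e1 : Real.log (2 * (a * y)) - Real.log (2 * (a * x)) ≤ (y - x) / x := by
      rw [← Real.log_div (by positivity) (by positivity)]
      refine (Real.log_le_sub_one_of_pos (by positivity)).trans (le_of_eq ?_)
      field_simp
    have e2 : (y - x) / (1 - x) ≤ Real.log (2 * (1 - x)) - Real.log (2 * (1 - y)) := by
      have hx1 : 0 < 1 - x := by linarith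
      have hy1 : 0 < 1 - y := by linarith
      rw [← Real.log_div (by positivity) (by positivity)]
      refine le_trans (le_of_eq ?_) (Real.one_sub_inv_le_log_of_pos (by positivity))
      field_simp
      ring
    have e3 : (y - x) / x ≤ c * ((y - x) / (1 - x)) := by
      have hx1 : 0 < 1 - x := by linarith
      rw [← mul_div_assoc, div_le_div_iff₀ hx0 hx1]
      nlinarith
    have e4 := mul_le_mul_of_nonneg_left e2 hc0.le
    linarith
  have high : ∀ x y, 1 / (1 + c) ≤ x → y ≤ x₀ → x ≤ y → 1 / 2 ≤ a * x →
      coord (f0 x₀ y₀ y) - coord (f0 x₀ y₀ x) ≤ c * (coord y - coord x) := by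
    intro x y hx hy hxy hay
    have hanti : AntitoneOn (fun t : ℝ => -Real.log (2 * (1 - a * t)) + a * Real.log (2 * (1 - t)))
        (Icc 0 x₀) := by
      have hd : ∀ t ∈ Icc (0:ℝ) x₀,
          HasDerivAt (fun t : ℝ => -Real.log (2 * (1 - a * t)) + a * Real.log (2 * (1 - t)))
            (a / (1 - a * t) - a / (1 - t)) t := by
        intro t ht
        have ht1 : 0 < 1 - t := by linarith [ht.2]
        have hat1 : 0 < 1 - a * t := by nlinarith [ht.1]
        have e1 : HasDerivAt (fun t : ℝ => 2 * (1 - a * t)) (2 * (-(a * 1))) t :=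
          ((((hasDerivAt_id t).const_mul a).const_sub 1).const_mul 2)
        have e2 : HasDerivAt (fun t : ℝ => 2 * (1 - t)) (2 * (-1)) t :=
          (((hasDerivAt_id t).const_sub 1).const_mul 2)
        have e3 := (e1.log (by positivity)).neg.add ((e2.log (by positivity)).const_mul a)
        refine e3.congr_deriv ?_
        field_simp
        ring
      refine antitoneOn_of_deriv_nonpos (convex_Icc _ _)
        (fun t ht => (hd t ht).continuousAt.continuousWithinAt)
        (fun t ht => (hd t (interior_subset ht)).differentiableAt.differentiableWithinAt) ?_
      intro t ht
      have ht := interior_subset ht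
      rw [(hd t ht).deriv, sub_nonpos]
      have ht1 : 0 < 1 - t := by linarith [ht.2]
      gcongr
      nlinarith [ht.1]
    have e1 := hanti (⟨by linarith, by linarith⟩ : x ∈ Icc 0 x₀) ⟨by linarith, hy⟩ hxy
    have e2 := sub_le_coord_sub (by linarith : 0 < x) (by linarith : y < 1) hxy
    have e3 := mul_le_mul_of_nonneg_right hc (by linarith : 0 ≤ coord y - coord x)
    refine le_trans ?_ e3
    rw [f0_of_le hy, f0_of_le (hxy.trans hy), coord_of_ge hay, coord_of_ge (by nlinarith),
      coord_of_ge (by linarith : 1 / 2 ≤ y), coord_of_ge (by linarith : 1 / 2 ≤ x)]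
    simp only at e1
    linarith
  rcases le_total (a * y) (1 / 2) with h | h
  · exact low x y hx hy hxy h
  rcases le_total (a * x) (1 / 2) with h' | h'
  · set m := 1 / 2 / a with hm
    have ham : a * m = 1 / 2 := by rw [hm]; field_simp
    have hxm : x ≤ m := by rw [hm, le_div_iff₀ ha0]; linarith
    have hmy : m ≤ y := by rw [hm, div_le_iff₀ ha0]; linarith
    linarith [low x m hx (hmy.trans hy) hxm ham.le, high m y (hx.trans hxm) hy hmy ham.ge]
  · exact high x y hx hy hxy h'

lemma log_ratio_neg (hA : A1 x₀ y₀) : Real.log (y₀ / x₀) < 0 := by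
  obtain ⟨h1, h2, h3, h4⟩ := hA
  exact Real.log_neg (div_pos (by linarith) (by linarith)) ((div_lt_one (by linarith)).2 h4)

lemma coord_f0_monotone (hA : A1 x₀ y₀) {x y : ℝ} (hx : 0 < x) (hy : y < 1) (hxy : x ≤ y) :
    coord (f0 x₀ y₀ x) ≤ coord (f0 x₀ y₀ y) := by
  have h := (f0_strictMono hA).monotone hxy
  have := sub_le_coord_sub (f0_mem hA ⟨hx, hxy.trans_lt hy⟩).1 (f0_mem hA ⟨hx.trans_le hxy, hy⟩).2 h
  linarith

lemma coord_f0_nonexpansive (hA : A1 x₀ y₀) {x y : ℝ} (hx : 0 < x) (hy : y < 1) (hxy : x ≤ y) :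
    coord (f0 x₀ y₀ y) - coord (f0 x₀ y₀ x) ≤ coord y - coord x := by
  have hA' := hA
  obtain ⟨h1, h2, h3, h4⟩ := hA'
  have ha1 : y₀ / x₀ ≤ 1 := ((div_lt_one (by linarith)).2 h4).le
  have e1 : AntitoneOn (fun x => coord (f0 x₀ y₀ x) - coord x) (Ioc 0 (1 / 2)) := by
    intro x hx y hy _
    simp only [coord_f0_of_le_half hA hx.1 hx.2, coord_f0_of_le_half hA hy.1 hy.2]
    linarith
  have e2 : AntitoneOn (fun x => coord (f0 x₀ y₀ x) - coord x) (Icc (1 / 2) x₀) := by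
    intro x hx y hy hxy
    have := coord_f0_sub_le hA ha1 le_rfl (by norm_num; linarith [hx.1]) hy.2 hxy
    dsimp only
    linarith
  have e3 : AntitoneOn (fun x => coord (f0 x₀ y₀ x) - coord x) (Ico x₀ 1) := by
    intro x hx y hy _
    simp only [coord_f0_of_ge hA hx.2 hx.1, coord_f0_of_ge hA hy.2 hy.1]
    linarith
  have e12 := e1.union_right e2 (c := 1 / 2) (isGreatest_Ioc (by norm_num)) (isLeast_Icc h1.le)
  rw [Ioc_union_Icc_eq_Ioc (by norm_num) h1.le] at e12
  have e := e12.union_right e3 (isGreatest_Ioc (by linarith)) (isLeast_Ico h2)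
  rw [Ioc_union_Ico_eq_Ioo (by linarith) h2] at e
  have := e (⟨hx, hxy.trans_lt hy⟩ : x ∈ Ioo (0:ℝ) 1) ⟨hx.trans_le hxy, hy⟩ hxy
  dsimp only at this
  linarith

lemma abs_coord_f0_sub_le (hA : A1 x₀ y₀) {x y : ℝ} (hx : x ∈ Ioo (0:ℝ) 1)
    (hy : y ∈ Ioo (0:ℝ) 1) :
    |coord (f0 x₀ y₀ x) - coord (f0 x₀ y₀ y)| ≤ |coord x - coord y| := by
  wlog h : x ≤ y generalizing x y
  · rw [abs_sub_comm, abs_sub_comm (coord x)]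
    exact this hy hx (le_of_not_ge h)
  have h1 := coord_f0_monotone hA hx.1 hy.2 h
  have h2 := coord_f0_nonexpansive hA hx.1 hy.2 h
  rw [abs_sub_comm, abs_sub_comm (coord x)]
  exact abs_le_abs_of_nonneg (by linarith) h2

lemma abs_coord_fb_sub_le (hA : A1 x₀ y₀) (b : Bool) {x y : ℝ} (hx : x ∈ Ioo (0:ℝ) 1)
    (hy : y ∈ Ioo (0:ℝ) 1) :
    |coord (fb x₀ y₀ b x) - coord (fb x₀ y₀ b y)| ≤ |coord x - coord y| := by
  cases b
  · exact abs_coord_f0_sub_le hA hx hy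
  · change |coord (f1 x₀ y₀ x) - coord (f1 x₀ y₀ y)| ≤ _
    have := abs_coord_f0_sub_le hA (one_sub_mem hy) (one_sub_mem hx)
    rw [coord_one_sub, coord_one_sub] at this
    rw [coord_f1, coord_f1]
    convert this using 2 <;> ring

lemma abs_coord_f0_sub_log_le (hA : A1 x₀ y₀) {x : ℝ} (hx : x ∈ Ioo (0:ℝ) 1) :
    |coord (f0 x₀ y₀ x) - Real.log (y₀ / x₀)| ≤ |coord x| := by
  have h := abs_coord_f0_sub_le hA hx (y := 1 / 2) (by norm_num)
  rwa [coord_f0_of_le_half hA (by norm_num) le_rfl, coord_half, zero_add, sub_zero] at h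

lemma exists_abs_coord_fb_eq (b : Bool) {x : ℝ} (hx : x ∈ Ioo (0:ℝ) 1) :
    ∃ z ∈ Ioo (0:ℝ) 1, |coord z| = |coord x| ∧
      |coord (fb x₀ y₀ b x)| = |coord (f0 x₀ y₀ z)| := by
  cases b
  · exact ⟨x, hx, rfl, rfl⟩
  · refine ⟨1 - x, one_sub_mem hx, by rw [coord_one_sub, abs_neg], ?_⟩
    change |coord (f1 x₀ y₀ x)| = _
    rw [coord_f1, abs_neg]

lemma abs_coord_fb_le (hA : A1 x₀ y₀) (b : Bool) {x : ℝ} (hx : x ∈ Ioo (0:ℝ) 1) :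
    |coord (fb x₀ y₀ b x)| ≤ |coord x| + -Real.log (y₀ / x₀) := by
  obtain ⟨z, hz, hzx, hzf⟩ := exists_abs_coord_fb_eq (x₀ := x₀) (y₀ := y₀) b hx
  have h := abs_coord_f0_sub_log_le hA hz
  rw [hzf, ← hzx]
  have h2 := abs_sub_abs_le_abs_sub (coord (f0 x₀ y₀ z)) (Real.log (y₀ / x₀))
  rw [abs_of_neg (log_ratio_neg hA)] at h2
  linarith

lemma neg_log_ratio_lt_coord (hA : A1 x₀ y₀) : -Real.log (y₀ / x₀) < coord x₀ := by
  obtain ⟨h1, h2, h3, h4⟩ := hA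
  rw [coord_of_ge h1.le, neg_lt_neg_iff]
  refine Real.log_lt_log (by linarith) ?_
  rw [lt_div_iff₀ (by linarith)]
  nlinarith

lemma abs_coord_f0_le_of_lt (hA : A1 x₀ y₀) {τ x : ℝ}
    (hτ : 2 * τ ≤ coord x₀ - -Real.log (y₀ / x₀)) (hτ0 : 0 ≤ τ)
    (hx : x ∈ Ioo (0:ℝ) 1) (h : coord x₀ - τ < coord x) :
    |coord (f0 x₀ y₀ x)| ≤ coord x - -Real.log (y₀ / x₀) := by
  have hl := log_ratio_neg hA
  have hA' := hA
  obtain ⟨h1, h2, h3, h4⟩ := hA'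
  have hx0 : 0 < coord x := by linarith
  have h5 := (abs_le.1 (abs_coord_f0_sub_log_le hA hx)).2
  rw [abs_of_pos hx0] at h5
  have e0 : 0 ≤ coord (f0 x₀ y₀ x₀) := by
    have hf : f0 x₀ y₀ x₀ = y₀ := by rw [f0_of_le le_rfl, div_mul_cancel₀ _ (by linarith)]
    rw [hf, ← coord_half]
    linarith [sub_le_coord_sub (by norm_num : (0:ℝ) < 1 / 2) (by linarith : y₀ < 1) h3]
  have hlow : -τ ≤ coord (f0 x₀ y₀ x) := by
    rcases le_total x₀ x with hle | hle
    · linarith [coord_f0_monotone hA (by linarith) hx.2 hle]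
    · linarith [coord_f0_nonexpansive hA hx.1 h2 hle]
  exact abs_le.2 ⟨by linarith, by linarith⟩

lemma abs_coord_f0_sub_le_mul (hA : A1 x₀ y₀) {c x y : ℝ} (hc : y₀ / x₀ ≤ c) (hc1 : c ≤ 1)
    (hx : 1 / (1 + c) ≤ x) (hx' : x ≤ x₀) (hy : 1 / (1 + c) ≤ y) (hy' : y ≤ x₀) :
    |coord (f0 x₀ y₀ x) - coord (f0 x₀ y₀ y)| ≤ c * |coord x - coord y| := by
  wlog h : x ≤ y generalizing x y
  · rw [abs_sub_comm, abs_sub_comm (coord x)]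
    exact this hy hy' hx hx' (le_of_not_ge h)
  have hA' := hA
  obtain ⟨h1, h2, h3, h4⟩ := hA'
  have hc0 : 0 < c := (div_pos (by linarith) (by linarith)).trans_le hc
  have hx0 : 0 < x := lt_of_lt_of_le (by positivity) hx
  have e1 := coord_f0_monotone hA hx0 (by linarith : y < 1) h
  have e2 := sub_le_coord_sub hx0 (by linarith : y < 1) h
  rw [abs_sub_comm, abs_sub_comm (coord x), abs_of_nonneg (by linarith),
    abs_of_nonneg (by linarith)]
  exact coord_f0_sub_le hA hc hc1 hx hy' h

/-- Away from the centre and from the ends, one of the maps contracts near any given point. -/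
lemma exists_coord_contraction (hA : A1 x₀ y₀) {τ : ℝ} (hτ : 0 < τ) :
    ∃ c < 1, ∀ x ∈ Ioo (0:ℝ) 1, 2 * τ ≤ |coord x| → |coord x| ≤ coord x₀ - τ →
      ∃ b, ∀ y ∈ Ioo (0:ℝ) 1, |coord x - coord y| ≤ τ →
        |coord (fb x₀ y₀ b x) - coord (fb x₀ y₀ b y)| ≤ c * |coord x - coord y| := by
  have hA' := hA
  obtain ⟨h1, h2, h3, h4⟩ := hA'
  have ha0 : 0 < y₀ / x₀ := div_pos (by linarith) (by linarith)
  have ha1 : y₀ / x₀ < 1 := (div_lt_one (by linarith)).2 h4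
  set ξ := 1 - Real.exp (-τ) / 2 with hξ
  have he : Real.exp (-τ) < 1 := Real.exp_lt_one_iff.2 (by linarith)
  have hξ' : 1 / 2 < ξ := by linarith
  set c := max (y₀ / x₀) (1 / ξ - 1) with hc
  have hcξ : 1 / (1 + c) ≤ ξ := by
    have : 1 / ξ ≤ 1 + c := by linarith [le_max_right (y₀ / x₀) (1 / ξ - 1)]
    rw [div_le_iff₀ (by linarith)] at this
    have hc0 : 0 < c := ha0.trans_le (le_max_left _ _)
    rw [div_le_iff₀ (by linarith)]
    linarith
  have hc1 : c < 1 := by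
    refine max_lt ha1 ?_
    rw [sub_lt_iff_lt_add, div_lt_iff₀ (by linarith)]
    linarith
  have hge : ∀ x ∈ Ioo (0:ℝ) 1, τ ≤ coord x → 1 / (1 + c) ≤ x := by
    intro x hx hxτ
    refine hcξ.trans (le_of_coord_le (by linarith [Real.exp_pos (-τ)]) hx.1 ?_)
    have : coord ξ = τ := by
      have h5 : 2 * (1 - ξ) = Real.exp (-τ) := by rw [hξ]; ring
      rw [coord_of_ge hξ'.le, h5, Real.log_exp, neg_neg]
    rwa [this]
  have key : ∀ x ∈ Ioo (0:ℝ) 1, 2 * τ ≤ coord x → coord x ≤ coord x₀ - τ → ∀ y ∈ Ioo (0:ℝ) 1,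
      |coord x - coord y| ≤ τ →
        |coord (f0 x₀ y₀ x) - coord (f0 x₀ y₀ y)| ≤ c * |coord x - coord y| := by
    intro x hx hx1 hx2 y hy hxy
    obtain ⟨h5, h6⟩ := abs_le.1 hxy
    refine abs_coord_f0_sub_le_mul hA (le_max_left _ _) hc1.le (hge x hx (by linarith))
      (le_of_coord_le hx.2 (by linarith) (by linarith)) (hge y hy (by linarith))
      (le_of_coord_le hy.2 (by linarith) (by linarith))
  refine ⟨c, hc1, fun x hx hx1 hx2 => ?_⟩
  rcases le_total 0 (coord x) with h | h
  · rw [abs_of_nonneg h] at hx1 hx2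
    exact ⟨false, key x hx hx1 hx2⟩
  · rw [abs_of_nonpos h, ← coord_one_sub] at hx1 hx2
    refine ⟨true, fun y hy hxy => ?_⟩
    have e := key _ (one_sub_mem hx) hx1 hx2 _ (one_sub_mem hy)
    have e1 : |coord (1 - x) - coord (1 - y)| = |coord x - coord y| := by
      rw [coord_one_sub, coord_one_sub, neg_sub_neg, abs_sub_comm]
    change |coord (f1 x₀ y₀ x) - coord (f1 x₀ y₀ y)| ≤ _
    rw [coord_f1, coord_f1, neg_sub_neg, abs_sub_comm]
    rw [e1] at e
    exact e hxy

lemma exists_abs_coord_fb_le (hA : A1 x₀ y₀) {τ x : ℝ}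
    (hτ : 2 * τ ≤ coord x₀ - -Real.log (y₀ / x₀)) (hτ0 : 0 ≤ τ)
    (hx : x ∈ Ioo (0:ℝ) 1) (h : coord x₀ - τ < |coord x|) :
    ∃ b, |coord (fb x₀ y₀ b x)| ≤ |coord x| - -Real.log (y₀ / x₀) := by
  rcases le_total 0 (coord x) with h0 | h0
  · rw [abs_of_nonneg h0] at h ⊢
    exact ⟨false, abs_coord_f0_le_of_lt hA hτ hτ0 hx h⟩
  · rw [abs_of_nonpos h0, ← coord_one_sub] at h ⊢
    refine ⟨true, ?_⟩
    change |coord (f1 x₀ y₀ x)| ≤ _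
    rw [coord_f1, abs_neg]
    exact abs_coord_f0_le_of_lt hA hτ hτ0 (one_sub_mem hx) h

lemma le_abs_coord_fb (hA : A1 x₀ y₀) (b : Bool) {τ x : ℝ}
    (hτ : 4 * τ ≤ coord x₀ - -Real.log (y₀ / x₀)) (hτ' : 4 * τ ≤ -Real.log (y₀ / x₀))
    (hτ0 : 0 < τ) (hx : x ∈ Ioo (0:ℝ) 1) (h : |coord x| < 2 * τ) :
    2 * τ ≤ |coord (fb x₀ y₀ b x)| ∧ |coord (fb x₀ y₀ b x)| ≤ coord x₀ - τ := by
  obtain ⟨z, hz, hzx, hzf⟩ := exists_abs_coord_fb_eq (x₀ := x₀) (y₀ := y₀) b hx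
  have h1 := abs_le.1 (abs_coord_f0_sub_log_le hA hz)
  rw [hzx] at h1
  rw [hzf, abs_of_nonpos (by linarith)]
  constructor <;> linarith

end Maps

/-- A random walk with positive mean drift contracts small exponential moments. -/
lemma eventually_exp_moment_lt_one {q q' b α : ℝ} (hq : q + q' = 1) (h : 0 < q * b - q' * α) :
    ∀ᶠ γ in 𝓝[>] (0:ℝ), q * Real.exp (-γ * b) + q' * Real.exp (γ * α) < 1 := by
  have e1 : HasDerivAt (fun γ : ℝ => q * Real.exp (-γ * b) + q' * Real.exp (γ * α))
      (-(q * b - q' * α)) 0 := by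
    have := ((((hasDerivAt_id (0:ℝ)).neg.mul_const b).exp).const_mul q).add
      ((((hasDerivAt_id (0:ℝ)).mul_const α).exp).const_mul q')
    refine this.congr_deriv ?_
    simp only [Pi.neg_apply, id, neg_zero, zero_mul, Real.exp_zero]
    ring
  have e2 := hasDerivAt_iff_tendsto_slope_zero.1 e1
  have e3 := e2.eventually (gt_mem_nhds (neg_lt_zero.2 h))
  have e4 := e3.filter_mono (nhdsWithin_mono 0 (fun x (hx : 0 < x) => ne_of_gt hx))
  filter_upwards [e4, self_mem_nhdsWithin] with γ hγ hγ0
  have hγ0 : 0 < γ := hγ0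
  rw [smul_eq_mul, zero_add] at hγ
  have := neg_of_mul_neg_right hγ (by positivity)
  simp only [neg_zero, zero_mul, Real.exp_zero, mul_one, hq] at this
  linarith

section Dynamics

variable {x₀ y₀ : ℝ}

lemma exists_drift_at_right (hA : A1 x₀ y₀) {q₀ q₁ : ℝ → ℝ} {γ : ℝ}
    (h0 : ContinuousOn q₀ (Icc 0 1)) (h1 : ContinuousOn q₁ (Icc 0 1))
    (hlt : q₀ 1 * Real.exp (-γ * Real.log ((1 - y₀) / (1 - x₀))) +
      q₁ 1 * Real.exp (γ * -Real.log (y₀ / x₀)) < 1) :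
    ∃ l S, l < 1 ∧ ∀ x ∈ Ioo (0:ℝ) 1, S ≤ coord x →
      q₀ x * Real.exp (γ * |coord (f0 x₀ y₀ x)|) + q₁ x * Real.exp (γ * |coord (f1 x₀ y₀ x)|) ≤
        l * Real.exp (γ * |coord x|) := by
  obtain ⟨l, hl, hl1⟩ := exists_between hlt
  have hone : (1:ℝ) ∈ Icc (0:ℝ) 1 := by norm_num
  have hcont : ContinuousWithinAt
      (fun x => q₀ x * Real.exp (-γ * Real.log ((1 - y₀) / (1 - x₀))) +
        q₁ x * Real.exp (γ * -Real.log (y₀ / x₀))) (Icc 0 1) 1 :=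
    ((h0 1 hone).mul_const _).add ((h1 1 hone).mul_const _)
  obtain ⟨δ, hδ, hδl⟩ := Metric.mem_nhdsWithin_iff.1 (hcont.eventually (gt_mem_nhds hl))
  set S := max (coord x₀) (max (Real.log ((1 - y₀) / (1 - x₀))) (coord (1 - min δ 1 / 2)))
  refine ⟨l, S, hl1, fun x hx hxS => ?_⟩
  have hx₀ : coord x₀ ≤ coord x := (le_max_left _ _).trans hxS
  have hxb : Real.log ((1 - y₀) / (1 - x₀)) ≤ coord x :=
    (le_max_left _ _).trans ((le_max_right _ _).trans hxS)
  have hxd : coord (1 - min δ 1 / 2) ≤ coord x :=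
    (le_max_right _ _).trans ((le_max_right _ _).trans hxS)
  have hmin : 0 < min δ 1 := by positivity
  have hxd := le_of_coord_le (by linarith) hx.1 hxd
  have hxδ : x ∈ Metric.ball 1 δ := by
    rw [Metric.mem_ball, Real.dist_eq, abs_sub_comm, abs_of_pos (by linarith [hx.2])]
    linarith [min_le_left δ 1]
  have hval := hδl ⟨hxδ, hx.1.le, hx.2.le⟩
  have hα := log_ratio_neg hA
  have hA' := hA
  obtain ⟨g1, g2, g3, g4⟩ := hA'
  have hx' := le_of_coord_le g2 hx.1 hx₀
  have hc0 : 0 < coord x := by linarith [neg_log_ratio_lt_coord hA]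
  have e0 : |coord (f0 x₀ y₀ x)| = coord x - Real.log ((1 - y₀) / (1 - x₀)) := by
    rw [coord_f0_of_ge hA hx.2 hx', abs_of_nonneg (by linarith)]
  have e1 : |coord (f1 x₀ y₀ x)| = coord x + -Real.log (y₀ / x₀) := by
    rw [coord_f1, abs_neg, coord_f0_of_le_half hA (by linarith [hx.2]) (by linarith),
      coord_one_sub, abs_of_neg (by linarith)]
    ring
  rw [e0, e1, abs_of_pos hc0]
  have m0 : Real.exp (γ * (coord x - Real.log ((1 - y₀) / (1 - x₀)))) =
      Real.exp (-γ * Real.log ((1 - y₀) / (1 - x₀))) * Real.exp (γ * coord x) := by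
    rw [← Real.exp_add]; ring_nf
  have m1 : Real.exp (γ * (coord x + -Real.log (y₀ / x₀))) =
      Real.exp (γ * -Real.log (y₀ / x₀)) * Real.exp (γ * coord x) := by
    rw [← Real.exp_add]; ring_nf
  rw [m0, m1, ← mul_assoc, ← mul_assoc, ← add_mul]
  exact mul_le_mul_of_nonneg_right (le_of_lt hval) (Real.exp_pos _).le

/-- Positive Lyapunov exponents at the end points give a drift towards the centre. -/
lemma exists_drift (hA : A1 x₀ y₀) {p₀ p₁ : ℝ → ℝ} (hA3 : A3 p₀ p₁) (hA4 : A4 x₀ y₀ p₀ p₁) :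
    ∃ γ l S, 0 < γ ∧ 0 ≤ l ∧ l < 1 ∧ ∀ x ∈ Ioo (0:ℝ) 1, S ≤ |coord x| →
      p₀ x * Real.exp (γ * |coord (f0 x₀ y₀ x)|) + p₁ x * Real.exp (γ * |coord (f1 x₀ y₀ x)|) ≤
        l * Real.exp (γ * |coord x|) := by
  obtain ⟨c0, c1, hsum⟩ := hA3
  obtain ⟨L0, L1⟩ := hA4
  have s0 := (hsum 0 (by norm_num)).1
  have s1 := (hsum 1 (by norm_num)).1
  obtain ⟨γ, ⟨hγ1, hγ2⟩, hγ⟩ :=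
    (((eventually_exp_moment_lt_one (b := Real.log ((1 - y₀) / (1 - x₀)))
      (α := -Real.log (y₀ / x₀)) s1 (by linarith)).and
      (eventually_exp_moment_lt_one (b := Real.log ((1 - y₀) / (1 - x₀)))
        (α := -Real.log (y₀ / x₀)) (by linarith : p₁ 0 + p₀ 0 = 1) (by linarith))).and
      self_mem_nhdsWithin).exists
  have hmaps : MapsTo (fun t : ℝ => 1 - t) (Icc 0 1) (Icc 0 1) := fun t ht =>
    ⟨by linarith [ht.2], by linarith [ht.1]⟩
  have hc : ContinuousOn (fun t : ℝ => 1 - t) (Icc 0 1) := by fun_prop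
  obtain ⟨l₁, S₁, hl₁, h₁⟩ := exists_drift_at_right hA c0 c1 hγ1
  obtain ⟨l₂, S₂, hl₂, h₂⟩ := exists_drift_at_right hA (q₀ := fun t => p₁ (1 - t))
    (q₁ := fun t => p₀ (1 - t)) (γ := γ) (c1.comp hc hmaps) (c0.comp hc hmaps)
    (by simpa using hγ2)
  refine ⟨γ, max 0 (max l₁ l₂), max S₁ S₂, hγ, le_max_left _ _,
    max_lt one_pos (max_lt hl₁ hl₂), fun x hx hxS => ?_⟩
  have hexp := (Real.exp_pos (γ * |coord x|)).le
  rcases le_total 0 (coord x) with h | h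
  · have hS : S₁ ≤ coord x := by
      rw [abs_of_nonneg h] at hxS; exact (le_max_left _ _).trans hxS
    exact (h₁ x hx hS).trans (mul_le_mul_of_nonneg_right
      ((le_max_left _ _).trans (le_max_right _ _)) hexp)
  · have hS : S₂ ≤ coord (1 - x) := by
      rw [abs_of_nonpos h, ← coord_one_sub] at hxS; exact (le_max_right _ _).trans hxS
    have e := h₂ _ (one_sub_mem hx) hS
    have e0 : |coord (f0 x₀ y₀ (1 - x))| = |coord (f1 x₀ y₀ x)| := by rw [coord_f1, abs_neg]
    have e1 : |coord (f1 x₀ y₀ (1 - x))| = |coord (f0 x₀ y₀ x)| := by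
      rw [coord_f1, abs_neg, sub_sub_cancel]
    rw [e0, e1, coord_one_sub, abs_neg] at e
    simp only [sub_sub_cancel] at e
    rw [add_comm]
    exact e.trans (mul_le_mul_of_nonneg_right ((le_max_right _ _).trans (le_max_right _ _)) hexp)

/-- The orbits of `f₀ ∘ f₁` converge to its fixed point uniformly on compact sets. -/
lemma exists_comp_contraction (hA : A1 x₀ y₀) {e : ℝ} (he : 0 < e)
    (he' : e ≤ y₀ / (x₀ + y₀)) :
    ∃ θ, 0 ≤ θ ∧ θ < 1 ∧ ∀ x ∈ Icc e (1 - e), f0 x₀ y₀ (f1 x₀ y₀ x) ∈ Icc e (1 - e) ∧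
      |f0 x₀ y₀ (f1 x₀ y₀ x) - y₀ / (x₀ + y₀)| ≤ θ * |x - y₀ / (x₀ + y₀)| := by
  have hA' := hA
  obtain ⟨h1, h2, h3, h4⟩ := hA'
  set a := y₀ / x₀ with ha
  set A := (1 - y₀) / (1 - x₀) with hAd
  set X := y₀ / (x₀ + y₀) with hX
  have ha0 : 0 < a := div_pos (by linarith) (by linarith)
  have ha1 : a < 1 := (div_lt_one (by linarith)).2 h4
  have hAa : 1 < A * a := by
    rw [hAd, ha, div_mul_div_comm, one_lt_div (by nlinarith)]
    nlinarith
  have hax : a * x₀ = y₀ := div_mul_cancel₀ _ (by linarith)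
  have hAx : A * (1 - x₀) = 1 - y₀ := div_mul_cancel₀ _ (by linarith)
  have hA0 : 0 < A := div_pos (by linarith) (by linarith)
  have hXs : X * (x₀ + y₀) = y₀ := div_mul_cancel₀ _ (by linarith)
  have hXa : a * (1 - X) = X := by
    rw [hX, ha]; field_simp; ring
  have hX0 : 0 < X := div_pos (by linarith) (by linarith)
  have hX2 : X < 1 / 2 := by rw [hX, div_lt_iff₀ (by linarith)]; linarith
  have hX1 : 1 - X ≤ x₀ := by
    have : 1 - X = x₀ / (x₀ + y₀) := by rw [hX]; field_simp; ring
    rw [this, div_le_iff₀ (by linarith)]; nlinarith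
  have hXy : 1 - y₀ ≤ 1 - X := by
    rw [hX, sub_le_sub_iff_left, div_le_iff₀ (by linarith)]; nlinarith
  have f1le : ∀ x, 1 - x ≤ x₀ → f1 x₀ y₀ x = 1 - a * (1 - x) := fun x hx => by
    rw [f1, f0_of_le hx]
  have f1ge : ∀ x, x₀ ≤ 1 - x → f1 x₀ y₀ x = A * x := fun x hx => by
    rw [f1, f0_of_ge hA hx]; ring
  set θ := max (1 - (A * a - 1) * e) (a ^ 2) with hθ
  have hθ1 : 1 - (A * a - 1) * e ≤ θ := le_max_left _ _
  have hθ2 : a ^ 2 ≤ θ := le_max_right _ _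
  have hlt : θ < 1 := max_lt (by nlinarith) (by nlinarith)
  have left : ∀ x, e ≤ x → x ≤ X → f0 x₀ y₀ (f1 x₀ y₀ x) ≤ X ∧
      X - f0 x₀ y₀ (f1 x₀ y₀ x) ≤ θ * (X - x) := by
    intro x hx hxX
    rcases le_total (1 - x) x₀ with h | h
    · have : a * (1 - X) ≤ a * (1 - x) := by gcongr
      have hg : X - a * (1 - a * (1 - x)) = a ^ 2 * (X - x) := by linear_combination (a - 1) * hXa
      rw [f1le x h, f0_of_le (by linarith), ← ha]
      constructor
      · nlinarith [sq_nonneg a]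
      · rw [hg]; exact mul_le_mul_of_nonneg_right hθ2 (by linarith)
    · have hAx' : A * x ≤ 1 - y₀ := by rw [← hAx]; gcongr; linarith
      rw [f1ge x h, f0_of_le (by linarith), ← ha]
      constructor
      · rw [← hXa]; gcongr; linarith
      · refine le_trans ?_ (mul_le_mul_of_nonneg_right hθ1 (by linarith))
        have : (A * a - 1) * e * (X - x) ≤ (A * a - 1) * x := by
          rw [mul_assoc]
          refine mul_le_mul_of_nonneg_left ?_ (by linarith)
          nlinarith
        linarith
  have right : ∀ x, X ≤ x → x ≤ 1 - e → X ≤ f0 x₀ y₀ (f1 x₀ y₀ x) ∧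
      f0 x₀ y₀ (f1 x₀ y₀ x) - X ≤ θ * (x - X) := by
    intro x hxX hx
    rw [f1le x (by linarith)]
    rcases le_total (1 - a * (1 - x)) x₀ with h | h
    · have hg : a * (1 - a * (1 - x)) - X = a ^ 2 * (x - X) := by linear_combination (1 - a) * hXa
      rw [f0_of_le h, ← ha]
      constructor
      · nlinarith [sq_nonneg a]
      · rw [hg]; exact mul_le_mul_of_nonneg_right hθ2 (by linarith)
    · rw [f0_of_ge hA h, ← hAd, sub_sub_cancel]
      constructor
      · have : A * (a * (1 - x)) ≤ A * (1 - x₀) := by gcongr; linarith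
        linarith
      · refine le_trans ?_ (mul_le_mul_of_nonneg_right hθ1 (by linarith))
        have : (A * a - 1) * e * (x - X) ≤ (A * a - 1) * (1 - x) := by
          rw [mul_assoc]
          refine mul_le_mul_of_nonneg_left ?_ (by linarith)
          nlinarith
        linarith
  refine ⟨θ, (sq_nonneg a).trans hθ2, hlt, fun x hx => ?_⟩
  rcases le_total x X with h | h
  · obtain ⟨e1, e2⟩ := left x hx.1 h
    have e3 : θ * (X - x) ≤ X - x := mul_le_of_le_one_left (by linarith) hlt.le
    rw [abs_sub_comm, abs_sub_comm x, abs_of_nonneg (by linarith), abs_of_nonneg (by linarith)]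
    exact ⟨⟨by linarith [hx.1], by linarith⟩, e2⟩
  · obtain ⟨e1, e2⟩ := right x h hx.2
    have e3 : θ * (x - X) ≤ x - X := mul_le_of_le_one_left (by linarith) hlt.le
    rw [abs_of_nonneg (by linarith), abs_of_nonneg (by linarith)]
    exact ⟨⟨by linarith, by linarith [hx.2]⟩, e2⟩

lemma continuousAt_coord {x : ℝ} (hx : 0 < x) (h : x < 1 / 2) : ContinuousAt coord x := by
  have e : (fun t : ℝ => Real.log (2 * t)) =ᶠ[𝓝 x] coord :=
    Filter.mem_of_superset (Iio_mem_nhds h) fun t ht => (coord_of_le (le_of_lt ht)).symm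
  refine ContinuousAt.congr ?_ e
  exact ContinuousAt.log (by fun_prop) (by positivity)

/-- Iterating `f₀ ∘ f₁` brings the points with bounded `coord` close to the fixed point. -/
lemma exists_iterate_close (hA : A1 x₀ y₀) (M : ℝ) {δ : ℝ} (hδ : 0 < δ) :
    ∃ k : ℕ, 1 ≤ k ∧ ∀ x ∈ Ioo (0:ℝ) 1, |coord x| ≤ M →
      |coord (y₀ / (x₀ + y₀)) - coord ((fun x => f0 x₀ y₀ (f1 x₀ y₀ x))^[k] x)| < δ := by
  have hA' := hA
  obtain ⟨h1, h2, h3, h4⟩ := hA'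
  set X := y₀ / (x₀ + y₀) with hX
  have hX0 : 0 < X := div_pos (by linarith) (by linarith)
  have hX2 : X < 1 / 2 := by rw [hX, div_lt_iff₀ (by linarith)]; linarith
  obtain ⟨η, hη, hηδ⟩ := Metric.continuousAt_iff.1 (continuousAt_coord hX0 hX2) δ hδ
  set e := min X (Real.exp (-M) / 2) with he
  have he0 : 0 < e := lt_min hX0 (by positivity)
  have heX : e ≤ X := min_le_left _ _
  have hce : coord e ≤ -M := by
    rw [coord_of_le (by linarith), Real.log_le_iff_le_exp (by positivity)]
    linarith [min_le_right X (Real.exp (-M) / 2)]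
  obtain ⟨θ, hθ0, hθ1, hθ⟩ := exists_comp_contraction hA he0 heX
  obtain ⟨k, hk⟩ := exists_pow_lt_of_lt_one hη hθ1
  refine ⟨k + 1, by omega, fun x hx hxM => ?_⟩
  obtain ⟨hM1, hM2⟩ := abs_le.1 hxM
  have hxe : x ∈ Icc e (1 - e) := by
    have e1 := le_of_coord_le (by linarith) hx.1 (hce.trans hM1)
    have e2 := le_of_coord_le (x := e) (by linarith) (one_sub_mem hx).1
      (hce.trans (by rw [coord_one_sub]; linarith))
    exact ⟨e1, by linarith⟩
  have hiter : ∀ n : ℕ, (fun x => f0 x₀ y₀ (f1 x₀ y₀ x))^[n] x ∈ Icc e (1 - e) ∧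
      |(fun x => f0 x₀ y₀ (f1 x₀ y₀ x))^[n] x - X| ≤ θ ^ n := by
    intro n
    induction n with
    | zero =>
      refine ⟨hxe, ?_⟩
      rw [Function.iterate_zero_apply, pow_zero, abs_le]
      constructor <;> linarith [hx.1, hx.2]
    | succ n ih =>
      rw [Function.iterate_succ_apply']
      obtain ⟨e1, e2⟩ := hθ _ ih.1
      refine ⟨e1, e2.trans ?_⟩
      rw [pow_succ']
      exact mul_le_mul_of_nonneg_left ih.2 hθ0
  have := (hiter (k + 1)).2
  have hzη : dist ((fun x => f0 x₀ y₀ (f1 x₀ y₀ x))^[k + 1] x) X < η := by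
    rw [Real.dist_eq]
    refine (this.trans ?_).trans_lt hk
    exact pow_le_pow_of_le_one hθ0 hθ1.le (Nat.le_succ k)
  have := hηδ hzη
  rwa [dist_comm, Real.dist_eq] at this

end Dynamics

end AM

lemma AM.exists_pos_le {p₀ p₁ : ℝ → ℝ} (hA3 : AM.A3 p₀ p₁) :
    ∃ ρ, 0 < ρ ∧ ∀ x ∈ Icc (0:ℝ) 1, ρ ≤ p₀ x ∧ ρ ≤ p₁ x := by
  obtain ⟨c0, c1, hp⟩ := hA3
  have hne : (Icc (0:ℝ) 1).Nonempty := ⟨0, by norm_num⟩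
  obtain ⟨u, hu, hu'⟩ := isCompact_Icc.exists_isMinOn hne c0
  obtain ⟨v, hv, hv'⟩ := isCompact_Icc.exists_isMinOn hne c1
  refine ⟨min (p₀ u) (p₁ v), lt_min (hp u hu).2.1 (hp v hv).2.2.2.1, fun x hx => ?_⟩
  exact ⟨(min_le_left _ _).trans (hu' hx), (min_le_right _ _).trans (hv' hx)⟩

/-- for every bounded Lipschitz `φ : (0,1) → ℝ` and all `x, y ∈ (0,1)`,
`|Uⁿφ(x) − Uⁿφ(y)| → 0` as `n → ∞`. -/
theorem stmt19 (x₀ y₀ : ℝ) (p₀ p₁ : ℝ → ℝ)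
    (hA1 : AM.A1 x₀ y₀) (hA2 : AM.A2 p₀ p₁) (hA3 : AM.A3 p₀ p₁) (hA4 : AM.A4 x₀ y₀ p₀ p₁)
    (φ : ℝ → ℝ)
    (hφb : ∃ K : ℝ, ∀ t ∈ Set.Ioo (0:ℝ) 1, |φ t| ≤ K)
    (hφl : ∃ Lf : ℝ, 0 ≤ Lf ∧
      ∀ u ∈ Set.Ioo (0:ℝ) 1, ∀ v ∈ Set.Ioo (0:ℝ) 1, |φ u - φ v| ≤ Lf * |u - v|)
    (x y : ℝ) (hx : x ∈ Set.Ioo (0:ℝ) 1) (hy : y ∈ Set.Ioo (0:ℝ) 1) :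
    Filter.Tendsto
      (fun n : ℕ => |((AM.U x₀ y₀ p₀ p₁)^[n] φ) x - ((AM.U x₀ y₀ p₀ p₁)^[n] φ) y|)
      Filter.atTop (nhds 0) := by
  obtain ⟨K, hK⟩ := hφb
  obtain ⟨Lf, hLf0, hLf⟩ := hφl
  obtain ⟨ρ, hρ, hρp⟩ := AM.exists_pos_le hA3
  obtain ⟨γ, l, S, hγ, hl0, hl1, hfar⟩ := AM.exists_drift hA1 hA3 hA4
  obtain ⟨β, hβ, hβs⟩ := hA2
  have hsum := hA3.2.2
  set α := -Real.log (y₀ / x₀) with hα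
  have hα0 : 0 < α := neg_pos.2 (AM.log_ratio_neg hA1)
  have hαh : α < AM.coord x₀ := AM.neg_log_ratio_lt_coord hA1
  obtain ⟨τ, hτ, hτα, hτh⟩ : ∃ τ, 0 < τ ∧ 4 * τ ≤ α ∧ 4 * τ ≤ AM.coord x₀ - α := by
    refine ⟨min α (AM.coord x₀ - α) / 4, div_pos (lt_min hα0 (by linarith)) (by norm_num), ?_, ?_⟩
    · linarith [min_le_left α (AM.coord x₀ - α)]
    · linarith [min_le_right α (AM.coord x₀ - α)]
  obtain ⟨c, hc1, hc⟩ := AM.exists_coord_contraction hA1 hτ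
  let X := ↥(Ioo (0:ℝ) 1)
  let f : Bool → X → X := fun b z => ⟨AM.fb x₀ y₀ b z, AM.fb_mem hA1 b z.2⟩
  let p : Bool → X → ℝ := fun b z => if b then p₁ z else p₀ z
  let s : X → ℝ := fun z => AM.coord z
  let ψ : ℕ → X → ℝ := fun n z => ((AM.U x₀ y₀ p₀ p₁)^[n] φ) z
  have hIcc : ∀ z : X, (z : ℝ) ∈ Icc (0:ℝ) 1 := fun z => Ioo_subset_Icc_self z.2
  have hp : ∀ b z, ρ ≤ p b z := by
    rintro (_ | _) z
    · exact (hρp z (hIcc z)).1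
    · exact (hρp z (hIcc z)).2
  have hp0 : ∀ b z, 0 ≤ p b z := fun b z => hρ.le.trans (hp b z)
  have hp1 : ∀ z, p false z + p true z = 1 := fun z => (hsum z (hIcc z)).1
  have hne : ∀ b z w, |s (f b z) - s (f b w)| ≤ |s z - s w| := fun b z w =>
    AM.abs_coord_fb_sub_le hA1 b z.2 w.2
  have hjump : ∀ b z, |s (f b z)| ≤ |s z| + α := fun b z => AM.abs_coord_fb_le hA1 b z.2
  have hfar' : ∀ z, S ≤ |s z| →
      ∑ b, p b z * Real.exp (γ * |s (f b z)|) ≤ l * Real.exp (γ * |s z|) := by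
    intro z hz
    rw [Fintype.sum_bool, add_comm]
    exact hfar z z.2 hz
  have hψ : ∀ n z, ψ (n + 1) z = ∑ b, p b z * ψ n (f b z) := by
    intro n z
    simp only [ψ, Function.iterate_succ_apply']
    rw [Fintype.sum_bool, add_comm]
    rfl
  have hψK : ∀ n z, |ψ n z| ≤ K := by
    intro n
    induction n with
    | zero => exact fun z => hK z z.2
    | succ n ih =>
      intro z
      rw [hψ, Fintype.sum_bool]
      refine (abs_add_le _ _).trans ?_
      rw [abs_mul, abs_mul, abs_of_nonneg (hp0 _ _), abs_of_nonneg (hp0 _ _)]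
      have e1 := mul_le_mul_of_nonneg_left (ih (f true z)) (hp0 true z)
      have e2 := mul_le_mul_of_nonneg_left (ih (f false z)) (hp0 false z)
      have e3 : p true z * K + p false z * K = K := by rw [← add_mul, add_comm, hp1, one_mul]
      linarith
  obtain ⟨u, l', hl'0, hl'1, hu, hW⟩ := exists_contracting_weight (p := p) (f := f) (s := s)
    (τ := τ) (a := AM.coord x₀ - τ) (S := S) hρ hp hp1 hne hc1 hα0 hγ hl1
    (fun z hz b => AM.le_abs_coord_fb hA1 b hτh hτα hτ z.2 hz)
    (fun z hz hz' => by
      obtain ⟨b, hb⟩ := hc z z.2 hz hz'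
      exact ⟨b, fun w hw => hb w w.2 hw⟩)
    hjump
    (fun z hz => AM.exists_abs_coord_fb_le hA1 (by linarith) hτ.le z.2 hz) hfar'
  obtain ⟨H, hHc, hHm, hHnn, hH, hH0⟩ := exists_concave_dini_modulus (p := p₀) hl'0
    (fun t z hz w hw h => (hβ t z hz w hw h).1)
    (by simpa using hβs 1 zero_le_one l' hl'0 hl'1)
  let c₀ : X := ⟨y₀ / (x₀ + y₀), by
    obtain ⟨h1, h2, h3, h4⟩ := hA1
    exact ⟨div_pos (by linarith) (by linarith), (div_lt_one (by linarith)).2 (by linarith)⟩⟩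
  have hequi : ∀ ε, 0 < ε → ∃ δ, 0 < δ ∧ ∀ w, |s c₀ - s w| < δ → ∀ n, |ψ n c₀ - ψ n w| ≤ ε :=
    fun ε hε => dual_iterates_equicontinuous (p := p) (f := f) (s := s) (ψ := ψ) (L := Lf)
      hp0 hp1 hψ hψK hLf0
      (fun z w => (hLf z z.2 w w.2).trans
        (mul_le_mul_of_nonneg_left (AM.abs_sub_le_abs_coord_sub z.2 w.2) hLf0))
      hne hτ hu hW hHc hHm hHnn hl'0.le
      (fun z w t ht => hH z (hIcc z) w (hIcc w) t
        ((AM.abs_sub_le_abs_coord_sub z.2 w.2).trans ht)) hH0 c₀ hε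
  refine dual_iterates_tendsto (p := p) (f := f) (ψ := ψ) (v := fun z => Real.exp (γ * |s z|))
    (C := Real.exp (γ * (S + α))) hρ hp hp1 hψ hψK (fun z => (Real.exp_pos _).le) hl0 hl1
    (Real.exp_pos _).le ?_ c₀ ?_ ⟨x, hx⟩ ⟨y, hy⟩
  · intro z
    rcases le_total S |s z| with h | h
    · exact (hfar' z h).trans (le_add_of_nonneg_right (Real.exp_pos _).le)
    · have hle : ∀ b, Real.exp (γ * |s (f b z)|) ≤ Real.exp (γ * (S + α)) := by
        intro b
        gcongr
        linarith [hjump b z]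
      have h1 : ∑ b, p b z * Real.exp (γ * |s (f b z)|) ≤ ∑ b, p b z * Real.exp (γ * (S + α)) :=
        Finset.sum_le_sum fun b _ => mul_le_mul_of_nonneg_left (hle b) (hp0 b z)
      rw [← Finset.sum_mul, Fintype.sum_bool (fun b => p b z), add_comm, hp1, one_mul] at h1
      exact h1.trans (le_add_of_nonneg_left (mul_nonneg hl0 (Real.exp_pos _).le))
  · intro R ε hε
    obtain ⟨δ, hδ, hδε⟩ := hequi ε hε
    obtain ⟨k, hk, hkδ⟩ := AM.exists_iterate_close hA1 (Real.log R / γ) hδ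
    refine ⟨k, hk, fun z hz n => hδε _ ?_ n⟩
    have hval : (((fun z => f false (f true z))^[k] z : X) : ℝ) =
        (fun t => AM.f0 x₀ y₀ (AM.f1 x₀ y₀ t))^[k] z :=
      Function.Semiconj.iterate_right (f := Subtype.val)
        (ga := fun z : X => f false (f true z)) (fun _ => rfl) k z
    have hzM : |AM.coord z| ≤ Real.log R / γ := by
      rw [le_div_iff₀ hγ, Real.le_log_iff_exp_le ((Real.exp_pos _).trans_le hz), mul_comm]
      exact hz
    have := hkδ z z.2 hzM
    rw [← hval] at this
    exact this
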